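/- arXiv:1603.07958 — 2 statements merged into one kernel-verified Lean document; each statement's English description precedes it below -/
import Mathlib

section
/- Let $V$ be a vertex algebra, $M$ a $V$-module, and $g \in C^1(V,M)$. Let $f_z(a,b) = a\,{}_z\, g(b) - g(a\,{}_z\, b) + g(a)\,{}_z\, b$. Then $f$ satisfies the cocycle condition: for all $a,b,c \in V$ there exists $n \in \mathbb{N}$ such that $(x+z)^n\big[f_z(a\,{}_x\, b, c) + f_x(a,b)\,{}_z\, c\big] = (x+z)^n\big[a\,{}_{x+z}\, f_z(b,c) + f_{x+z}(a, b\,{}_z\, c)\big]$. Hence $\mathrm{Im}\,\delta_1 \subseteq Z^2(V,M)$. -/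
/- Coefficient-wise formalization of vertex algebras:
a series `w ∈ V((z))` is encoded by its coefficient function `ℤ → V`
(the value at `n` being the coefficient of `z^n`), and a field/product
`a ⊗ b ↦ a_z b ∈ V((z))` by a map `V → V → ℤ → V`. -/

namespace VertexCohomology

open scoped BigOperators

section Defs

variable (𝕜 : Type*) [Field 𝕜] [CharZero 𝕜]
variable {V W M : Type*} [AddCommGroup V] [Module 𝕜 V] [AddCommGroup M] [Module 𝕜 M]

/-- Coefficient of `z^n` in `e^{z d} w(z)`, where `w` is a series with coefficients `w n`. -/
noncomputable def ezd (d : M →ₗ[𝕜] M) (w : ℤ → M) : ℤ → M :=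
  fun n => ∑ᶠ k : ℕ, ((k.factorial : 𝕜)⁻¹) • (d ^ k) (w (n - (k : ℤ)))

/-- Coefficient of `z^n` in `w(-z)`. -/
def negz (w : ℤ → M) : ℤ → M := fun n => ((n.negOnePow : ℤ)) • w n

/-- Coefficient of `z^n` in `(d/dz) w(z)`. -/
def derivz (w : ℤ → M) : ℤ → M := fun n => (n + 1) • w (n + 1)

/-- The constant series with value `a`. -/
def unitSeries (a : M) : ℤ → M := fun n => if n = 0 then a else 0

/-- Coefficient of `z^m w^n` in `(z+w)^l · F(z,w)`, where `F m n` is the coefficient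
of `z^m w^n` of a formal series in two variables. -/
def mulZW (l : ℕ) (F : ℤ → ℤ → M) : ℤ → ℤ → M :=
  fun m n => ∑ k ∈ Finset.range (l + 1), (l.choose k : ℤ) • F (m - ((l - k : ℕ) : ℤ)) (n - (k : ℤ))

/-- Coefficient of `x^m y^n` in `(x-y)^l · F(x,y)`. -/
def mulZmW (l : ℕ) (F : ℤ → ℤ → M) : ℤ → ℤ → M :=
  fun m n => ∑ k ∈ Finset.range (l + 1),
    ((-1 : ℤ) ^ k * (l.choose k : ℤ)) • F (m - ((l - k : ℕ) : ℤ)) (n - (k : ℤ))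

/-- Coefficient of `z^m w^n` in `F(a, ·)_{z+w}` applied to the series `u` in the
variable `w`; here `(z+w)^j` is expanded in nonnegative powers of `w`:
`(z+w)^j = ∑_{i ≥ 0} C(j,i) z^{j-i} w^i`. -/
noncomputable def shiftComp (F : V → W → ℤ → M) (a : V) (u : ℤ → W) : ℤ → ℤ → M :=
  fun m n => ∑ᶠ i : ℕ, (Ring.choose (m + (i : ℤ)) i) • F a (u (n - (i : ℤ))) (m + (i : ℤ))

/-- The axioms of a vertex algebra, stated coefficient-wise:
`Y a b n` is the coefficient of `z^n` in `a_z b`. -/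
structure IsVertexAlg (Y : V → V → ℤ → V) (one : V) (D : V →ₗ[𝕜] V) : Prop where
  linear_left : ∀ (b : V) (n : ℤ), IsLinearMap 𝕜 (fun a => Y a b n)
  linear_right : ∀ (a : V) (n : ℤ), IsLinearMap 𝕜 (fun b => Y a b n)
  trunc : ∀ a b, ∃ N : ℤ, ∀ n < N, Y a b n = 0
  unit_left : ∀ a, Y one a = unitSeries a
  unit_right : ∀ a, Y a one = ezd 𝕜 D (unitSeries a)
  transl : ∀ a b, Y (D a) b = derivz (Y a b)
  derivation : ∀ a b n, D (Y a b n) = Y (D a) b n + Y a (D b) n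
  comm : ∀ a b, Y a b = ezd 𝕜 D (negz (Y b a))
  assoc : ∀ a b c, ∃ l : ℕ,
    mulZW l (fun m n => Y (Y a b m) c n) = mulZW l (shiftComp Y a (Y b c))

/-- The axioms of a module over a vertex algebra, stated coefficient-wise. -/
structure IsVModule (Y : V → V → ℤ → V) (one : V) (D : V →ₗ[𝕜] V)
    (YM : V → M → ℤ → M) (d : M →ₗ[𝕜] M) : Prop where
  linear_left : ∀ (u : M) (n : ℤ), IsLinearMap 𝕜 (fun a => YM a u n)
  linear_right : ∀ (a : V) (n : ℤ), IsLinearMap 𝕜 (fun u => YM a u n)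
  trunc : ∀ a u, ∃ N : ℤ, ∀ n < N, YM a u n = 0
  unit : ∀ u, YM one u = unitSeries u
  transl : ∀ a u, YM (D a) u = derivz (YM a u)
  derivation : ∀ a u n, d (YM a u n) = YM (D a) u n + YM a (d u) n
  assoc : ∀ a b u, ∃ l : ℕ,
    mulZW l (fun m n => YM (Y a b m) u n) = mulZW l (shiftComp YM a (YM b u))

/-- The right action `u_z a := e^{z d}(a_{-z} u)` of `V` on `M`. -/
noncomputable def rAct (YM : V → M → ℤ → M) (d : M →ₗ[𝕜] M) (u : M) (a : V) : ℤ → M :=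
  ezd 𝕜 d (negz (YM a u))

/-- `(δ₁ g)_z (a,b) = a_z g(b) - g(a_z b) + g(a)_z b`. -/
noncomputable def delta1 (Y : V → V → ℤ → V) (YM : V → M → ℤ → M) (d : M →ₗ[𝕜] M)
    (g : V → M) (a b : V) : ℤ → M :=
  fun n => YM a (g b) n - g (Y a b n) + rAct 𝕜 YM d (g a) b n

/-- Membership in `C²(V,M)`. -/
structure IsC2 (one : V) (D : V →ₗ[𝕜] V) (d : M →ₗ[𝕜] M) (f : V → V → ℤ → M) : Prop where
  linear_left : ∀ (b : V) (n : ℤ), IsLinearMap 𝕜 (fun a => f a b n)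
  linear_right : ∀ (a : V) (n : ℤ), IsLinearMap 𝕜 (fun b => f a b n)
  trunc : ∀ a b, ∃ N : ℤ, ∀ n < N, f a b n = 0
  unit_right : ∀ a, f a one = 0
  unit_left : ∀ b, f one b = 0
  transl : ∀ a b, derivz (f a b) = f (D a) b
  derivation : ∀ a b n, d (f a b n) = f (D a) b n + f a (D b) n
  symm : ∀ a b, f a b = ezd 𝕜 d (negz (f b a))

/-- The 2-cocycle condition: for all `a,b,c` there is `N` with
`(x+z)^N [f_z(a_x b, c) + f_x(a,b)_z c] = (x+z)^N [a_{x+z} f_z(b,c) + f_{x+z}(a, b_z c)]`,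
coefficients taken at `x^m z^n`, `(x+z)^j` expanded in nonnegative powers of `z`. -/
def Cocycle (Y : V → V → ℤ → V) (YM : V → M → ℤ → M) (d : M →ₗ[𝕜] M)
    (f : V → V → ℤ → M) : Prop :=
  ∀ a b c : V, ∃ N : ℕ,
    mulZW N (fun m n => f (Y a b m) c n + rAct 𝕜 YM d (f a b m) c n)
      = mulZW N (fun m n => shiftComp YM a (f b c) m n + shiftComp f a (Y b c) m n)

/-- The square-zero extension product on `V ⊕ M`:
`(a,u)_z (b,v) = (a_z b, a_z v + u_z b + ψ_z(a,b))`. -/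
noncomputable def extY (Y : V → V → ℤ → V) (YM : V → M → ℤ → M) (d : M →ₗ[𝕜] M)
    (ψ : V → V → ℤ → M) : V × M → V × M → ℤ → V × M :=
  fun p q n => (Y p.1 q.1 n, YM p.1 q.2 n + rAct 𝕜 YM d p.2 q.1 n + ψ p.1 q.1 n)

/-- The first-order deformed product on `V[t]/(t²) ≃ V × V` (first component the
constant term, second the coefficient of `t`): `a_z^t b = a_z b + t f_z(a,b)`. -/
def defY (Y : V → V → ℤ → V) (f : V → V → ℤ → V) : V × V → V × V → ℤ → V × V :=
  fun p q n => (Y p.1 q.1 n, Y p.1 q.2 n + Y p.2 q.1 n + f p.1 q.1 n)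

end Defs

section Aux

set_option linter.unusedSectionVars false

variable (𝕜 : Type*) [Field 𝕜] [CharZero 𝕜]
variable {A B C : Type*} [AddCommGroup A] [Module 𝕜 A] [AddCommGroup B] [Module 𝕜 B]
  [AddCommGroup C] [Module 𝕜 C]

/-- Lower-truncated series. -/
def bdd (A : Type*) [AddCommGroup A] [Module 𝕜 A] : Submodule 𝕜 (ℤ → A) where
  carrier := {w | ∃ N : ℤ, ∀ n < N, w n = 0}
  add_mem' := by
    rintro a b ⟨N, hN⟩ ⟨K, hK⟩
    refine ⟨min N K, fun n hn => ?_⟩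
    simp [hN n (lt_of_lt_of_le hn (min_le_left _ _)), hK n (lt_of_lt_of_le hn (min_le_right _ _))]
  zero_mem' := ⟨0, fun _ _ => rfl⟩
  smul_mem' := by
    rintro c a ⟨N, hN⟩
    exact ⟨N, fun n hn => by simp [hN n hn]⟩

/-- The module of lower-truncated series. -/
structure LS (A : Type*) [AddCommGroup A] [Module 𝕜 A] where
  /-- coefficients -/
  val : ℤ → A
  /-- truncation -/
  prop : val ∈ bdd 𝕜 A

variable {𝕜}

theorem LS.ext {v w : LS 𝕜 A} (h : ∀ n, v.1 n = w.1 n) : v = w := by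
  cases v; cases w
  congr
  exact funext h

theorem LS.val_inj : Function.Injective (LS.val : LS 𝕜 A → (ℤ → A)) :=
  fun _ _ h => LS.ext (fun n => congrFun h n)

instance : Zero (LS 𝕜 A) := ⟨⟨0, (bdd 𝕜 A).zero_mem⟩⟩
instance : Add (LS 𝕜 A) := ⟨fun v w => ⟨v.1 + w.1, (bdd 𝕜 A).add_mem v.2 w.2⟩⟩
instance : Neg (LS 𝕜 A) := ⟨fun v => ⟨-v.1, (bdd 𝕜 A).neg_mem v.2⟩⟩
instance : Sub (LS 𝕜 A) := ⟨fun v w => ⟨v.1 - w.1, (bdd 𝕜 A).sub_mem v.2 w.2⟩⟩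
instance instSMulLS : SMul 𝕜 (LS 𝕜 A) := ⟨fun c v => ⟨c • v.1, (bdd 𝕜 A).smul_mem c v.2⟩⟩
instance instSMulNatLS : SMul ℕ (LS 𝕜 A) := ⟨fun c v => ⟨c • v.1, nsmul_mem v.2 c⟩⟩
instance instSMulIntLS : SMul ℤ (LS 𝕜 A) := ⟨fun c v => ⟨c • v.1, zsmul_mem v.2 c⟩⟩

instance instAddCommGroupLS : AddCommGroup (LS 𝕜 A) :=
  Function.Injective.addCommGroup LS.val LS.val_inj rfl (fun _ _ => rfl) (fun _ => rfl)
    (fun _ _ => rfl) (fun _ _ => rfl) (fun _ _ => rfl)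

/-- The coefficient map. -/
def LS.valHom : LS 𝕜 A →+ (ℤ → A) where
  toFun := LS.val
  map_zero' := rfl
  map_add' _ _ := rfl

instance instModuleLS : Module 𝕜 (LS 𝕜 A) :=
  Function.Injective.module 𝕜 LS.valHom LS.val_inj (fun _ _ => rfl)

@[simp] theorem LS.coe_add (v w : LS 𝕜 A) : (v + w).1 = v.1 + w.1 := rfl
@[simp] theorem LS.coe_sub (v w : LS 𝕜 A) : (v - w).1 = v.1 - w.1 := rfl
@[simp] theorem LS.coe_neg (v : LS 𝕜 A) : (-v).1 = -v.1 := rfl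
@[simp] theorem LS.coe_zero : (0 : LS 𝕜 A).1 = 0 := rfl
@[simp] theorem LS.coe_smul (c : 𝕜) (v : LS 𝕜 A) : (c • v).1 = c • v.1 := rfl
@[simp] theorem LS.coe_zsmul (c : ℤ) (v : LS 𝕜 A) : (c • v).1 = c • v.1 := rfl

theorem ezd_eq (Δ : A →ₗ[𝕜] A) (w : ℤ → A) (N : ℤ) (hN : ∀ n < N, w n = 0) (n : ℤ) (K : ℕ)
    (hK : n - N < K) :
    ezd 𝕜 Δ w n = ∑ k ∈ Finset.range K, ((k.factorial : 𝕜)⁻¹) • (Δ ^ k) (w (n - (k : ℤ))) := by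
  unfold ezd
  apply finsum_eq_sum_of_support_subset
  intro k hk
  simp only [Finset.coe_range, Set.mem_Iio]
  by_contra h
  apply hk
  change _ • (Δ ^ k) (w (n - (k : ℤ))) = 0
  rw [hN _ (by omega)]
  simp

/-- `e^{zΔ}` on truncated series. -/
noncomputable def EE (Δ : A →ₗ[𝕜] A) : LS 𝕜 A →ₗ[𝕜] LS 𝕜 A where
  toFun w := ⟨ezd 𝕜 Δ w.1, by
    obtain ⟨N, hN⟩ := w.2
    refine ⟨N, fun n hn => ?_⟩
    rw [ezd_eq Δ _ N hN n 0 (by simp; omega)]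
    simp⟩
  map_add' v w := by
    obtain ⟨N, hN⟩ := v.2
    obtain ⟨K, hK⟩ := w.2
    obtain ⟨P, hP⟩ := (v + w).2
    apply LS.ext
    intro n
    obtain ⟨T, h1, h2, h3⟩ : ∃ T : ℕ, n - N < T ∧ n - K < T ∧ n - P < T :=
      ⟨(n - N).toNat + (n - K).toNat + (n - P).toNat + 1, by omega, by omega, by omega⟩
    simp only [LS.coe_add, Pi.add_apply]
    rw [ezd_eq Δ _ N hN n T h1, ezd_eq Δ _ K hK n T h2]
    have := ezd_eq Δ _ P hP n T h3
    simp only [LS.coe_add] at this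
    rw [this, ← Finset.sum_add_distrib]
    simp
  map_smul' c v := by
    obtain ⟨N, hN⟩ := v.2
    obtain ⟨P, hP⟩ := (c • v).2
    apply LS.ext
    intro n
    obtain ⟨T, h1, h3⟩ : ∃ T : ℕ, n - N < T ∧ n - P < T :=
      ⟨(n - N).toNat + (n - P).toNat + 1, by omega, by omega⟩
    simp only [LS.coe_smul, Pi.smul_apply, RingHom.id_apply]
    rw [ezd_eq Δ _ N hN n T h1]
    have := ezd_eq Δ _ P hP n T h3
    simp only [LS.coe_smul] at this
    rw [this, Finset.smul_sum]
    refine Finset.sum_congr rfl fun k _ => ?_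
    simp only [Pi.smul_apply, map_smul]
    rw [smul_comm]

theorem EE_coe (Δ : A →ₗ[𝕜] A) (w : LS 𝕜 A) : (EE Δ w).1 = ezd 𝕜 Δ w.1 := rfl

theorem EE_eq (Δ : A →ₗ[𝕜] A) (w : LS 𝕜 A) (N : ℤ) (hN : ∀ n < N, w.1 n = 0) (n : ℤ) (K : ℕ)
    (hK : n - N < K) :
    (EE Δ w).1 n = ∑ k ∈ Finset.range K, ((k.factorial : 𝕜)⁻¹) • (Δ ^ k) (w.1 (n - (k : ℤ))) :=
  ezd_eq Δ w.1 N hN n K hK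

/-- Coefficientwise application of a linear map. -/
def mp (φ : A →ₗ[𝕜] B) : LS 𝕜 A →ₗ[𝕜] LS 𝕜 B where
  toFun w := ⟨fun n => φ (w.1 n), by
    obtain ⟨N, hN⟩ := w.2
    exact ⟨N, fun n hn => by simp [hN n hn]⟩⟩
  map_add' v w := by apply LS.ext; simp
  map_smul' v w := by apply LS.ext; simp

@[simp] theorem mp_coe (φ : A →ₗ[𝕜] B) (w : LS 𝕜 A) (n : ℤ) : (mp φ w).1 n = φ (w.1 n) := rfl

/-- Multiplication by the variable. -/
def sh : LS 𝕜 A →ₗ[𝕜] LS 𝕜 A where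
  toFun w := ⟨fun n => w.1 (n - 1), by
    obtain ⟨N, hN⟩ := w.2
    exact ⟨N, fun n hn => hN _ (by omega)⟩⟩
  map_add' v w := by apply LS.ext; simp
  map_smul' v w := by apply LS.ext; simp

@[simp] theorem sh_coe (w : LS 𝕜 A) (n : ℤ) : (sh w).1 n = w.1 (n - 1) := rfl

/-- Derivative. -/
def der : LS 𝕜 A →ₗ[𝕜] LS 𝕜 A where
  toFun w := ⟨fun n => (n + 1) • w.1 (n + 1), by
    obtain ⟨N, hN⟩ := w.2
    exact ⟨N - 1, fun n hn => by simp [hN (n + 1) (by omega)]⟩⟩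
  map_add' v w := by apply LS.ext; simp
  map_smul' v w := by
    apply LS.ext; intro n
    simp only [LS.coe_smul, Pi.smul_apply, RingHom.id_apply]
    rw [smul_comm]

@[simp] theorem der_coe (w : LS 𝕜 A) (n : ℤ) : (der w).1 n = (n + 1) • w.1 (n + 1) := rfl

/-- Substitution of the negated variable. -/
def ng : LS 𝕜 A →ₗ[𝕜] LS 𝕜 A where
  toFun w := ⟨negz w.1, by
    obtain ⟨N, hN⟩ := w.2
    exact ⟨N, fun n hn => by simp [negz, hN _ hn]⟩⟩
  map_add' v w := by apply LS.ext; simp [negz]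
  map_smul' v w := by
    apply LS.ext; intro n
    simp only [negz, LS.coe_smul, Pi.smul_apply, RingHom.id_apply]
    rw [smul_comm]

theorem ng_coe (w : LS 𝕜 A) (n : ℤ) : (ng w).1 n = ((n.negOnePow : ℤ)) • w.1 n := rfl

theorem mp_comp (φ : A →ₗ[𝕜] B) (ψ : B →ₗ[𝕜] C) (w : LS 𝕜 A) : mp ψ (mp φ w) = mp (ψ ∘ₗ φ) w := rfl

theorem mp_sh (φ : A →ₗ[𝕜] B) (w : LS 𝕜 A) : mp φ (sh w) = sh (mp φ w) := rfl

theorem mp_der (φ : A →ₗ[𝕜] B) (w : LS 𝕜 A) : mp φ (der w) = der (mp φ w) := by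
  apply LS.ext; intro n; simp

theorem mp_ng (φ : A →ₗ[𝕜] B) (w : LS 𝕜 A) : mp φ (ng w) = ng (mp φ w) := by
  apply LS.ext; intro n; simp [ng_coe]

theorem der_ng (w : LS 𝕜 A) : der (ng w) = - ng (der w) := by
  apply LS.ext; intro n
  simp only [der_coe, ng_coe, LS.coe_neg, Pi.neg_apply, Int.negOnePow_succ]
  simp [smul_smul, mul_comm]

theorem ng_sh (w : LS 𝕜 A) : ng (sh w) = - sh (ng w) := by
  apply LS.ext; intro n
  simp [ng_coe, Int.negOnePow_sub]

theorem ng_ng (w : LS 𝕜 A) : ng (ng w) = w := by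
  apply LS.ext; intro n
  rcases Int.even_or_odd n with h | h <;> simp [ng_coe, Int.negOnePow_even, Int.negOnePow_odd, h]

theorem mp_pow_comm (φ : A →ₗ[𝕜] B) (Δ : A →ₗ[𝕜] A) (Δ' : B →ₗ[𝕜] B)
    (h : ∀ a, φ (Δ a) = Δ' (φ a)) (k : ℕ) (a : A) : φ ((Δ ^ k) a) = (Δ' ^ k) (φ a) := by
  induction k generalizing a with
  | zero => simp
  | succ k ih => rw [pow_succ, pow_succ, Module.End.mul_apply, Module.End.mul_apply, ih, h]

theorem mp_EE (φ : A →ₗ[𝕜] B) (Δ : A →ₗ[𝕜] A) (Δ' : B →ₗ[𝕜] B)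
    (h : ∀ a, φ (Δ a) = Δ' (φ a)) (w : LS 𝕜 A) : mp φ (EE Δ w) = EE Δ' (mp φ w) := by
  obtain ⟨N, hN⟩ := w.2
  apply LS.ext; intro n
  rw [mp_coe, EE_eq Δ w N hN n ((n - N).toNat + 1) (by omega),
    EE_eq Δ' _ N (fun i hi => by simp [hN i hi]) n ((n - N).toNat + 1) (by omega), map_sum]
  refine Finset.sum_congr rfl fun k _ => ?_
  rw [map_smul, mp_pow_comm φ Δ Δ' h, mp_coe]

theorem sh_EE (Δ : A →ₗ[𝕜] A) (w : LS 𝕜 A) : sh (EE Δ w) = EE Δ (sh w) := by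
  obtain ⟨N, hN⟩ := w.2
  apply LS.ext; intro n
  rw [sh_coe, EE_eq Δ w N hN (n-1) ((n - N).toNat + 1) (by omega),
    EE_eq Δ _ N (fun i hi => by simp [hN (i-1) (by omega)]) n ((n - N).toNat + 1) (by omega)]
  refine Finset.sum_congr rfl fun k _ => ?_
  rw [sh_coe]
  congr 3
  ring_nf

theorem ng_EE (Δ : A →ₗ[𝕜] A) (w : LS 𝕜 A) : ng (EE Δ w) = EE (-Δ) (ng w) := by
  obtain ⟨N, hN⟩ := w.2
  apply LS.ext; intro n
  rw [ng_coe, EE_eq Δ w N hN n ((n - N).toNat + 1) (by omega),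
    EE_eq _ _ N (fun i hi => by simp [ng_coe, hN i hi]) n ((n - N).toNat + 1) (by omega),
    Finset.smul_sum]
  refine Finset.sum_congr rfl fun k _ => ?_
  rw [ng_coe, neg_pow, smul_comm, Int.negOnePow_sub]
  congr 1
  rcases Nat.even_or_odd k with h | h
  · have : Even (k : ℤ) := by exact_mod_cast h
    simp [h.neg_one_pow, Int.negOnePow_even _ this]
  · have : Odd (k : ℤ) := by exact_mod_cast h
    simp [h.neg_one_pow, Int.negOnePow_odd _ this]

theorem EE_zero (w : LS 𝕜 A) : EE (0 : A →ₗ[𝕜] A) w = w := by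
  obtain ⟨N, hN⟩ := w.2
  apply LS.ext; intro n
  rw [EE_eq _ w N hN n ((n - N).toNat + 1) (by omega), Finset.sum_range_succ',
    Finset.sum_eq_zero]
  · simp
  · intro k _
    simp

theorem exp_add (Δ Δ' : A →ₗ[𝕜] A) (h : Commute Δ Δ') (m : ℕ) (a : A) :
    ((m.factorial : 𝕜)⁻¹) • ((Δ + Δ') ^ m) a = ∑ k ∈ Finset.range (m + 1),
      ((k.factorial : 𝕜)⁻¹) • (Δ ^ k) ((((m - k).factorial : 𝕜)⁻¹) • (Δ' ^ (m - k)) a) := by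
  rw [h.add_pow, LinearMap.sum_apply, Finset.smul_sum]
  refine Finset.sum_congr rfl fun k hk => ?_
  have hk : k ≤ m := by simpa [Nat.lt_succ_iff] using hk
  rw [map_smul, smul_smul]
  have : ((Δ ^ k * Δ' ^ (m - k) * (m.choose k : A →ₗ[𝕜] A)) a)
    = (m.choose k : 𝕜) • (Δ ^ k) ((Δ' ^ (m - k)) a) := by
    simp [Module.End.mul_apply, Module.End.natCast_apply, Nat.cast_smul_eq_nsmul]
  rw [this, smul_smul]
  congr 1
  rw [Nat.cast_choose 𝕜 hk]
  have := Nat.factorial_ne_zero m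
  field_simp

theorem EE_add (Δ Δ' : A →ₗ[𝕜] A) (h : Commute Δ Δ') (w : LS 𝕜 A) :
    EE (Δ + Δ') w = EE Δ (EE Δ' w) := by
  obtain ⟨N, hN⟩ := w.2
  have hN' : ∀ i < N, (EE Δ' w).1 i = 0 := by
    intro i hi
    rw [EE_eq Δ' w N hN i 0 (by simp; omega)]
    simp
  apply LS.ext; intro n
  set K := (n - N).toNat + 1 with hK
  rw [EE_eq _ w N hN n K (by omega), EE_eq _ _ N hN' n K (by omega)]
  have e1 : ∀ k ∈ Finset.range K, ((k.factorial : 𝕜)⁻¹) • (Δ ^ k) ((EE Δ' w).1 (n - k)) =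
      ∑ j ∈ Finset.range (K - k), ((k.factorial : 𝕜)⁻¹) • (Δ ^ k)
        (((j.factorial : 𝕜)⁻¹) • (Δ' ^ j) (w.1 (n - ((k + j : ℕ) : ℤ)))) := by
    intro k hk
    have := Finset.mem_range.1 hk
    rw [EE_eq Δ' w N hN (n - k) (K - k) (by omega), map_sum, Finset.smul_sum]
    refine Finset.sum_congr rfl fun j _ => ?_
    congr 5
    push_cast; ring_nf
  rw [Finset.sum_congr rfl e1, ← Finset.sum_range_diag_flip K (fun k j =>
    ((k.factorial : 𝕜)⁻¹) • (Δ ^ k)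
        (((j.factorial : 𝕜)⁻¹) • (Δ' ^ j) (w.1 (n - ((k + j : ℕ) : ℤ)))))]
  refine Finset.sum_congr rfl fun m _ => ?_
  rw [exp_add Δ Δ' h]
  refine Finset.sum_congr rfl fun k hk => ?_
  have : k ≤ m := by simpa [Nat.lt_succ_iff] using hk
  rw [Nat.add_sub_cancel' this]

theorem EE_neg_EE (Δ : A →ₗ[𝕜] A) (w : LS 𝕜 A) : EE (-Δ) (EE Δ w) = w := by
  rw [← EE_add _ _ (Commute.neg_left (Commute.refl Δ)), neg_add_cancel, EE_zero]

theorem EE_EE_neg (Δ : A →ₗ[𝕜] A) (w : LS 𝕜 A) : EE Δ (EE (-Δ) w) = w := by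
  rw [← EE_add _ _ (Commute.neg_right (Commute.refl Δ)), add_neg_cancel, EE_zero]

theorem fact_aux (k : ℕ) : (((k + 1).factorial : 𝕜)⁻¹) * ((k : 𝕜) + 1) = ((k.factorial : 𝕜)⁻¹) := by
  rw [Nat.factorial_succ]
  have h1 : (k.factorial : 𝕜) ≠ 0 := by exact_mod_cast Nat.factorial_ne_zero k
  have h2 : (k : 𝕜) + 1 ≠ 0 := by exact_mod_cast Nat.succ_ne_zero k
  push_cast
  field_simp

theorem der_EE (Δ : A →ₗ[𝕜] A) (w : LS 𝕜 A) :
    der (EE Δ w) = EE Δ (der w + mp Δ w) := by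
  obtain ⟨N, hN⟩ := w.2
  apply LS.ext; intro n
  rw [map_add]
  set K := (n - N).toNat + 3 with hK
  rw [der_coe, LS.coe_add, Pi.add_apply, EE_eq _ w N hN (n + 1) (K+1) (by omega),
    EE_eq _ (der w) (N - 1) (fun i hi => by simp [hN (i + 1) (by omega)]) n (K + 1) (by omega),
    EE_eq _ (mp Δ w) N (fun i hi => by simp [hN i (by omega)]) n K (by omega),
    Finset.smul_sum]
  have key : ∀ k : ℕ, (n + 1) • (((k.factorial : 𝕜)⁻¹) • (Δ ^ k) (w.1 (n + 1 - k)))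
      = ((k.factorial : 𝕜)⁻¹) • (Δ ^ k) ((der w).1 (n - k)) +
        (((k.factorial : 𝕜)⁻¹) * (k : 𝕜)) • (Δ ^ k) (w.1 (n + 1 - k)) := by
    intro k
    rw [der_coe, map_zsmul, show n - (k : ℤ) + 1 = n + 1 - k by ring, ← Int.cast_smul_eq_zsmul 𝕜,
      ← Int.cast_smul_eq_zsmul 𝕜, smul_smul, smul_smul, ← add_smul]
    congr 1
    push_cast; ring
  rw [Finset.sum_congr rfl (fun k _ => key k), Finset.sum_add_distrib]
  congr 1
  rw [Finset.sum_range_succ']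
  simp only [Nat.cast_zero, mul_zero, zero_smul, add_zero]
  refine Finset.sum_congr rfl fun k _ => ?_
  rw [pow_succ, Module.End.mul_apply, mp_coe]
  push_cast
  rw [fact_aux]
  congr 4
  ring_nf

theorem EE_heis (Δ φ : A →ₗ[𝕜] A) (h : ∀ a, Δ (φ a) = φ (Δ a) + a) (w : LS 𝕜 A) :
    EE Δ (mp φ w) = mp φ (EE Δ w) + sh (EE Δ w) := by
  have hp : ∀ (k : ℕ) (a : A), (Δ ^ (k + 1)) (φ a) = φ ((Δ ^ (k + 1)) a)
      + ((k : 𝕜) + 1) • (Δ ^ k) a := by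
    intro k
    induction k with
    | zero => intro a; simp [h]
    | succ k ih =>
      intro a
      rw [pow_succ, Module.End.mul_apply, h, map_add, ih, Module.End.mul_apply,
        ← Module.End.mul_apply (Δ ^ k), ← pow_succ]
      push_cast
      module
  obtain ⟨N, hN⟩ := w.2
  apply LS.ext; intro n
  set K := (n - N).toNat + 3 with hK
  rw [LS.coe_add, Pi.add_apply, mp_coe, sh_coe,
    EE_eq _ (mp φ w) N (fun i hi => by simp [hN i (by omega)]) n (K + 1) (by omega),
    EE_eq _ w N hN n (K + 1) (by omega), EE_eq _ w N hN (n - 1) K (by omega),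
    Finset.sum_range_succ', Finset.sum_range_succ' _ K, map_add, map_sum, add_right_comm,
    ← Finset.sum_add_distrib]
  congr 1
  · refine Finset.sum_congr rfl fun k _ => ?_
    rw [mp_coe, hp, map_smul, smul_add, smul_smul, fact_aux]
    congr 4
    push_cast; ring_nf
  · simp

/-- operators on iterated series -/
abbrev EL (𝕜 A : Type*) [Field 𝕜] [CharZero 𝕜] [AddCommGroup A] [Module 𝕜 A] := Module.End 𝕜 (LS 𝕜 (LS 𝕜 A))

/-- operators on raw coefficient functions -/
abbrev ER (𝕜 A : Type*) [Field 𝕜] [CharZero 𝕜] [AddCommGroup A] [Module 𝕜 A] := Module.End 𝕜 (ℤ → ℤ → A)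

/-- raw multiplication by `x` -/
def XX : Module.End 𝕜 (ℤ → ℤ → A) where
  toFun F := fun m n => F (m - 1) n
  map_add' _ _ := rfl
  map_smul' _ _ := rfl

/-- raw multiplication by `z` -/
def ZZ : Module.End 𝕜 (ℤ → ℤ → A) where
  toFun F := fun m n => F m (n - 1)
  map_add' _ _ := rfl
  map_smul' _ _ := rfl

/-- coefficients, outer variable `x` -/
def rx : LS 𝕜 (LS 𝕜 A) →ₗ[𝕜] (ℤ → ℤ → A) where
  toFun w := fun m n => (w.1 m).1 n
  map_add' _ _ := rfl
  map_smul' _ _ := rfl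

/-- coefficients, outer variable `z` -/
def rz : LS 𝕜 (LS 𝕜 A) →ₗ[𝕜] (ℤ → ℤ → A) where
  toFun w := fun m n => (w.1 n).1 m
  map_add' _ _ := rfl
  map_smul' _ _ := rfl

/-- inner variable multiplication -/
def Xi : Module.End 𝕜 (LS 𝕜 (LS 𝕜 A)) := mp sh

/-- outer variable multiplication -/
def Zo : Module.End 𝕜 (LS 𝕜 (LS 𝕜 A)) := sh

theorem XX_pow (k : ℕ) (F : ℤ → ℤ → A) (m n : ℤ) :
    ((XX (𝕜 := 𝕜) ^ k) F) m n = F (m - k) n := by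
  induction k generalizing m with
  | zero => simp
  | succ k ih =>
    rw [pow_succ', Module.End.mul_apply]
    change ((XX (𝕜 := 𝕜) ^ k) F) (m - 1) n = _
    rw [ih]; congr 1; push_cast; ring

theorem ZZ_pow (k : ℕ) (F : ℤ → ℤ → A) (m n : ℤ) :
    ((ZZ (𝕜 := 𝕜) ^ k) F) m n = F m (n - k) := by
  induction k generalizing n with
  | zero => simp
  | succ k ih =>
    rw [pow_succ', Module.End.mul_apply]
    change ((ZZ (𝕜 := 𝕜) ^ k) F) m (n - 1) = _
    rw [ih]; congr 1; push_cast; ring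

theorem XZ_comm : Commute (XX : Module.End 𝕜 (ℤ → ℤ → A)) ZZ := rfl

theorem XiZo_comm : Commute (Xi : Module.End 𝕜 (LS 𝕜 (LS 𝕜 A))) Zo := rfl

theorem mulZW_eq (l : ℕ) (F : ℤ → ℤ → A) :
    mulZW l F = ((XX + ZZ : ER 𝕜 A) ^ l) F := by
  funext m n
  rw [add_comm, (XZ_comm (𝕜 := 𝕜) (A := A)).symm.add_pow, LinearMap.sum_apply]
  simp only [mulZW, Finset.sum_apply]
  refine Finset.sum_congr rfl fun k _ => ?_
  simp only [Module.End.mul_apply, Module.End.natCast_apply]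
  rw [map_nsmul, map_nsmul]
  simp only [Pi.smul_apply]
  rw [ZZ_pow, XX_pow, natCast_zsmul]

theorem rx_Zo (w : LS 𝕜 (LS 𝕜 A)) : rx (Zo w) = XX (𝕜 := 𝕜) (rx w) := rfl
theorem rx_Xi (w : LS 𝕜 (LS 𝕜 A)) : rx (Xi w) = ZZ (𝕜 := 𝕜) (rx w) := rfl
theorem rz_Zo (w : LS 𝕜 (LS 𝕜 A)) : rz (Zo w) = ZZ (𝕜 := 𝕜) (rz w) := rfl
theorem rz_Xi (w : LS 𝕜 (LS 𝕜 A)) : rz (Xi w) = XX (𝕜 := 𝕜) (rz w) := rfl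

theorem heis (a : LS 𝕜 A) : der (sh a) = sh (der a) + a := by
  apply LS.ext; intro n
  simp [add_smul]

theorem T_Xi (w : LS 𝕜 (LS 𝕜 A)) : EE der (Xi w) = (Xi + Zo : EL 𝕜 A) (EE der w) :=
  EE_heis der sh heis w

theorem T_Zo (w : LS 𝕜 (LS 𝕜 A)) : EE der (Zo w) = Zo (EE der w) := (sh_EE _ _).symm

theorem T_sub (w : LS 𝕜 (LS 𝕜 A)) : EE der ((Xi - Zo : EL 𝕜 A) w) = Xi (EE der w) := by
  rw [LinearMap.sub_apply, map_sub, T_Xi, T_Zo, LinearMap.add_apply, add_sub_cancel_right]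

theorem T_Xi_pow (k : ℕ) (w : LS 𝕜 (LS 𝕜 A)) :
    EE der ((Xi ^ k) w) = ((Xi + Zo : EL 𝕜 A) ^ k) (EE der w) := mp_pow_comm (EE der) Xi (Xi + Zo : EL 𝕜 A) T_Xi k w

theorem T_Zo_pow (k : ℕ) (w : LS 𝕜 (LS 𝕜 A)) :
    EE der ((Zo ^ k) w) = (Zo ^ k) (EE der w) := mp_pow_comm (EE der) Zo Zo T_Zo k w

theorem T_sub_pow (k : ℕ) (w : LS 𝕜 (LS 𝕜 A)) :
    EE der (((Xi - Zo : EL 𝕜 A) ^ k) w) = (Xi ^ k) (EE der w) := mp_pow_comm (EE der) (Xi - Zo : EL 𝕜 A) Xi T_sub k w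

theorem T_sub_pow' (k : ℕ) (w : LS 𝕜 (LS 𝕜 A)) :
    EE der (((Zo - Xi : EL 𝕜 A) ^ k) w) = ((-Xi : EL 𝕜 A) ^ k) (EE der w) :=
  mp_pow_comm (EE der) (Zo - Xi : EL 𝕜 A) (-Xi : EL 𝕜 A) (fun w => by
    rw [← neg_sub, LinearMap.neg_apply, map_neg, T_sub, LinearMap.neg_apply]) k w

theorem ng_Zo (w : LS 𝕜 (LS 𝕜 A)) : ng (Zo w) = (-Zo : EL 𝕜 A) (ng w) := ng_sh w
theorem ng_Xi (w : LS 𝕜 (LS 𝕜 A)) : ng (Xi w) = Xi (ng w) := (mp_ng _ _).symm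

/-- evaluation of a coefficient -/
def evl (m : ℤ) : LS 𝕜 A →ₗ[𝕜] A where
  toFun w := w.1 m
  map_add' _ _ := rfl
  map_smul' _ _ := rfl

theorem der_pow (k : ℕ) (v : LS 𝕜 A) (m : ℤ) : ((der ^ k) v).1 m =
    ((k.factorial : ℤ) * Ring.choose (m + k) k) • v.1 (m + k) := by
  induction k generalizing m with
  | zero => simp
  | succ k ih =>
    rw [pow_succ', Module.End.mul_apply, der_coe, ih, smul_smul]
    have h := Ring.choose_add_smul_choose (m + 1) 1 k
    rw [Ring.choose_one_right, nsmul_eq_mul, add_comm 1 k, Nat.choose_succ_self_right] at h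
    have e : m + ((k + 1 : ℕ) : ℤ) = m + 1 + k := by push_cast; ring
    rw [e, Nat.factorial_succ]
    congr 1
    push_cast at h ⊢
    linear_combination -(k.factorial : ℤ) * h

theorem T_eq (w : LS 𝕜 (LS 𝕜 A)) (N : ℤ) (hN : ∀ n < N, w.1 n = 0) (n : ℤ) (K : ℕ)
    (hK : n - N < K) (m : ℤ) :
    ((EE der w).1 n).1 m = ∑ k ∈ Finset.range K,
      (Ring.choose (m + (k : ℤ)) k) • (w.1 (n - (k : ℤ))).1 (m + (k : ℤ)) := by
  change evl (𝕜 := 𝕜) m ((EE der w).1 n) = _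
  rw [EE_eq der w N hN n K hK, map_sum]
  refine Finset.sum_congr rfl fun k _ => ?_
  rw [map_smul]
  change _ • ((der ^ k) (w.1 (n - k))).1 m = _
  rw [der_pow, ← Int.cast_smul_eq_zsmul 𝕜, smul_smul, ← Int.cast_smul_eq_zsmul 𝕜]
  congr 1
  have h1 : (k.factorial : 𝕜) ≠ 0 := by exact_mod_cast Nat.factorial_ne_zero k
  push_cast
  field_simp

theorem shiftComp_eq (F : C → B → ℤ → A) (a : C) (Φ : B →ₗ[𝕜] LS 𝕜 A)
    (hΦ : ∀ v, (Φ v).1 = F a v) (u : LS 𝕜 B) :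
    shiftComp F a u.1 = rz (EE der (mp Φ u)) := by
  obtain ⟨N, hN⟩ := u.2
  funext m n
  change _ = ((EE der (mp Φ u)).1 n).1 m
  rw [T_eq (mp Φ u) N (fun i hi => by simp [hN i hi]) n ((n - N).toNat + 1) (by omega)]
  unfold shiftComp
  simp only [mp_coe, hΦ]
  apply finsum_eq_sum_of_support_subset
  intro k hk
  simp only [Finset.coe_range, Set.mem_Iio]
  by_contra h
  apply hk
  change _ • F a (u.1 (n - (k : ℤ))) _ = 0
  rw [hN _ (by omega), ← hΦ, map_zero]
  simp

/-- quadrant support -/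
def Quad (w : LS 𝕜 (LS 𝕜 A)) : Prop := ∀ m n : ℤ, (m < 0 ∨ n < 0) → (w.1 m).1 n = 0

theorem T_quad (w : LS 𝕜 (LS 𝕜 A)) (hw : Quad w) : Quad (EE der w) := by
  intro n m h
  have h0 : ∀ i < 0, w.1 i = 0 := fun i hi => LS.ext fun j => by simp [hw i j (Or.inl hi)]
  rw [T_eq w 0 h0 n (n.toNat + 1) (by omega)]
  apply Finset.sum_eq_zero
  intro k hk
  rcases h with h | h
  · rw [hw _ _ (Or.inl (by omega)), smul_zero]
  · by_cases h2 : m + k < 0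
    · rw [hw _ _ (Or.inr h2), smul_zero]
    · obtain ⟨p, hp⟩ := Int.eq_ofNat_of_zero_le (not_lt.1 h2)
      rw [hp, Ring.choose_natCast, Nat.choose_eq_zero_of_lt (by omega)]
      simp

theorem T_quad_eq (w : LS 𝕜 (LS 𝕜 A)) (hw : Quad w) (m n : ℕ) :
    ((EE der w).1 (n : ℤ)).1 (m : ℤ) = ∑ s ∈ Finset.range (m + n + 1),
      (s.choose m : ℤ) • (w.1 ((m + n - s : ℕ) : ℤ)).1 (s : ℤ) := by
  have h0 : ∀ i < 0, w.1 i = 0 := fun i hi => LS.ext fun j => by simp [hw i j (Or.inl hi)]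
  rw [T_eq w 0 h0 n (n + 1) (by omega), add_assoc m n 1, Finset.sum_range_add _ m (n + 1)]
  rw [Finset.sum_eq_zero (s := Finset.range m), zero_add]
  · refine Finset.sum_congr rfl fun k hk => ?_
    have := Finset.mem_range.1 hk
    have e1 : (m : ℤ) + k = ((m + k : ℕ) : ℤ) := by push_cast; rfl
    have e2 : (n : ℤ) - k = ((m + n - (m + k) : ℕ) : ℤ) := by omega
    rw [e1, e2, Ring.choose_natCast, Nat.choose_symm_add]
  · intro s hs
    rw [Nat.choose_eq_zero_of_lt (Finset.mem_range.1 hs)]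
    simp

theorem ng_quad (w : LS 𝕜 (LS 𝕜 A)) (hw : Quad w) : Quad (ng w) := by
  intro m n h
  rw [ng_coe]
  rw [LS.coe_zsmul, Pi.smul_apply]
  rw [hw m n h, smul_zero]

theorem ng_nat (w : LS 𝕜 (LS 𝕜 A)) (m : ℕ) (n : ℤ) :
    ((ng w).1 (m : ℤ)).1 n = ((-1 : ℤ) ^ m) • (w.1 (m : ℤ)).1 n := by
  rw [ng_coe]
  rw [LS.coe_zsmul, Pi.smul_apply]
  congr 1

theorem comb (m n s : ℕ) (hs : s ≤ m + n) :
    ∑ t ∈ Finset.range (m + n + 1),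
      (-1 : ℤ) ^ t * ((m + n - s).choose t : ℤ) * ((m + n - t).choose m : ℤ) = (s.choose n : ℤ) := by
  have h := Ring.add_choose_eq (R := ℤ) (r := ((m + n - s : ℕ) : ℤ)) (s := -((m : ℤ) + 1)) n
    (Commute.all _ _)
  have e : ((m + n - s : ℕ) : ℤ) + -((m : ℤ) + 1) = - ((s : ℤ) - n + 1) := by omega
  rw [e, Ring.choose_neg, show (s : ℤ) - n + 1 + n - 1 = s by ring, Ring.choose_natCast,
    Finset.Nat.sum_antidiagonal_eq_sum_range_succ_mk] at h
  have h2 : ∀ k ∈ Finset.range n.succ, Ring.choose ((m + n - s : ℕ) : ℤ) k *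
      Ring.choose (-((m : ℤ) + 1)) (n - k) = (-1) ^ n * ((-1 : ℤ) ^ k * ((m + n - s).choose k : ℤ) *
        ((m + n - k).choose m : ℤ)) := by
    intro k hk
    have hk : k ≤ n := by simpa [Nat.lt_succ_iff] using hk
    rw [Ring.choose_neg, Ring.choose_natCast,
      show (m : ℤ) + 1 + (n - k : ℕ) - 1 = ((m + (n - k) : ℕ) : ℤ) by push_cast; ring,
      Ring.choose_natCast, ← Nat.choose_symm_add, ← Nat.add_sub_assoc hk]
    have : (-1 : ℤ) ^ n * (-1) ^ k = (-1) ^ (n - k) := by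
      obtain ⟨j, rfl⟩ := Nat.exists_eq_add_of_le hk
      rw [Nat.add_sub_cancel_left, pow_add, mul_right_comm, ← mul_pow]
      simp
    have h3 : ∀ y : ℤ, (Int.negOnePow ((n - k : ℕ) : ℤ)) • y = (-1) ^ (n - k) * y := fun y => rfl
    simp only [h3, ← this]
    ring
  rw [Finset.sum_congr rfl h2, ← Finset.mul_sum] at h
  have h3 : ∀ y : ℤ, (Int.negOnePow (n : ℤ)) • y = (-1) ^ n * y := fun y => rfl
  rw [h3] at h
  have h4 := mul_left_cancel₀ (pow_ne_zero n (by norm_num : (-1 : ℤ) ≠ 0)) h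
  rw [h4, show m + n + 1 = n.succ + m by omega, Finset.sum_range_add]
  rw [add_eq_left]
  apply Finset.sum_eq_zero
  intro k hk
  rw [Nat.choose_eq_zero_of_lt (n := m + n - (n.succ + k))]
  · simp
  · have := Finset.mem_range.1 hk
    omega

theorem inv_form (w : LS 𝕜 (LS 𝕜 A)) : w = ng (EE der (ng (EE der w))) := by
  rw [ng_EE, ng_ng, EE_neg_EE]

theorem inv_quad (w : LS 𝕜 (LS 𝕜 A)) (h : Quad (EE der w)) : Quad w := by
  rw [inv_form w]
  exact ng_quad _ (T_quad _ (ng_quad _ h))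

theorem inv_quad_eq (w : LS 𝕜 (LS 𝕜 A)) (h : Quad (EE der w)) (m n : ℕ) :
    (w.1 (n : ℤ)).1 (m : ℤ) = ∑ s ∈ Finset.range (m + n + 1),
      ((-1) ^ n * (s.choose m : ℤ) * (-1) ^ (m + n - s)) •
        ((EE der w).1 ((m + n - s : ℕ) : ℤ)).1 (s : ℤ) := by
  conv_lhs => rw [inv_form w]
  rw [ng_nat, T_quad_eq _ (ng_quad _ h), Finset.smul_sum]
  refine Finset.sum_congr rfl fun s _ => ?_
  rw [ng_nat, smul_smul, smul_smul]

theorem quad_loc (P Q R R' : LS 𝕜 (LS 𝕜 A)) (h1 : rz (EE der Q) = rx R')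
    (h2 : R = EE der (ng R')) (h3 : rz (EE der P) = rx R) (hq : Quad R') : rz P = rx Q := by
  have hR : Quad R := h2 ▸ T_quad _ (ng_quad _ hq)
  have e1 : ∀ m n : ℤ, ((EE der Q).1 n).1 m = (R'.1 m).1 n := fun m n => congrFun (congrFun h1 m) n
  have e3 : ∀ m n : ℤ, ((EE der P).1 n).1 m = (R.1 m).1 n := fun m n => congrFun (congrFun h3 m) n
  have qQ : Quad (EE der Q) := fun m n h => by rw [e1, hq _ _ h.symm]
  have qP : Quad (EE der P) := fun m n h => by rw [e3, hR _ _ h.symm]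
  funext m n
  change (P.1 n).1 m = (Q.1 m).1 n
  by_cases hm : m < 0
  · rw [inv_quad _ qP _ _ (Or.inr hm), inv_quad _ qQ _ _ (Or.inl hm)]
  by_cases hn : n < 0
  · rw [inv_quad _ qP _ _ (Or.inl hn), inv_quad _ qQ _ _ (Or.inr hn)]
  obtain ⟨m, rfl⟩ := Int.eq_ofNat_of_zero_le (not_lt.1 hm)
  obtain ⟨n, rfl⟩ := Int.eq_ofNat_of_zero_le (not_lt.1 hn)
  rw [inv_quad_eq P qP, inv_quad_eq Q qQ]
  have e4 : ∀ s ∈ Finset.range (m + n + 1), ((EE der P).1 ((m + n - s : ℕ) : ℤ)).1 (s : ℤ) =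
      ∑ t ∈ Finset.range (m + n + 1), (((m + n - t).choose (m + n - s) : ℤ) * (-1) ^ t) •
        (R'.1 (t : ℤ)).1 ((m + n - t : ℕ) : ℤ) := by
    intro s hs
    have hs : s ≤ m + n := by simpa [Nat.lt_succ_iff] using hs
    rw [e3, h2, T_quad_eq _ (ng_quad _ hq), Nat.sub_add_cancel hs, ← Finset.sum_range_reflect]
    refine Finset.sum_congr rfl fun t ht => ?_
    have ht : t ≤ m + n := by simpa [Nat.lt_succ_iff] using ht
    rw [show m + n + 1 - 1 - t = m + n - t by omega, ng_nat, smul_smul,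
      show m + n - (m + n - t) = t by omega]
  rw [Finset.sum_congr rfl (fun s hs => by rw [e4 s hs, Finset.smul_sum]), Finset.sum_comm,
    add_comm n m]
  refine Finset.sum_congr rfl fun t ht => ?_
  have ht : t ≤ m + n := by simpa [Nat.lt_succ_iff] using ht
  rw [e1]
  simp only [smul_smul]
  rw [← Finset.sum_smul]
  congr 1
  rw [← comb m n t ht, Finset.mul_sum, Finset.sum_mul, ← Finset.sum_range_reflect]
  refine Finset.sum_congr rfl fun s hs => ?_
  have hs : s ≤ m + n := by simpa [Nat.lt_succ_iff] using hs
  rw [show m + n + 1 - 1 - s = m + n - s by omega, show m + n - (m + n - s) = s by omega]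
  have hsign : (-1 : ℤ) ^ n * (-1) ^ t = (-1) ^ m * (-1) ^ (m + n - t) := by
    rw [← pow_add, ← pow_add]
    apply neg_one_pow_congr
    constructor <;> intro h <;> · rw [Nat.even_iff] at *; omega
  linear_combination ((m + n - s).choose m : ℤ) * (-1) ^ s * ((m + n - t).choose s : ℤ) * hsign

theorem swapc {B : Type*} [AddCommGroup B] [Module 𝕜 B] {f g : Module.End 𝕜 B} (h : Commute f g)
    (k l : ℕ) (w : B) : (f ^ k) ((g ^ l) w) = (g ^ l) ((f ^ k) w) := by
  rw [← Module.End.mul_apply, (h.pow_pow k l).eq, Module.End.mul_apply]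

theorem neg_pow_app {B : Type*} [AddCommGroup B] [Module 𝕜 B] (f : Module.End 𝕜 B)
    (k : ℕ) (w : B) : ((-f) ^ k) w = ((-1 : ℤ) ^ k) • (f ^ k) w := by
  induction k with
  | zero => simp
  | succ k ih =>
    rw [pow_succ', Module.End.mul_apply, ih, pow_succ', pow_succ', Module.End.mul_apply,
      LinearMap.neg_apply, map_zsmul, mul_smul, neg_one_smul]

theorem cXs : Commute (Xi : EL 𝕜 A) (Xi + Zo) := (Commute.refl _).add_right XiZo_comm
theorem cXd : Commute (Xi : EL 𝕜 A) (Xi - Zo) := (Commute.refl _).sub_right XiZo_comm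
theorem cZs : Commute (Zo : EL 𝕜 A) (Xi + Zo) := XiZo_comm.symm.add_right (Commute.refl _)
theorem cXXd : Commute (XX : ER 𝕜 A) (XX - ZZ) := (Commute.refl _).sub_right XZ_comm
theorem cZZd : Commute (ZZ : ER 𝕜 A) (XX - ZZ) := XZ_comm.symm.sub_right (Commute.refl _)
theorem cXXs : Commute (XX : ER 𝕜 A) (XX + ZZ) := (Commute.refl _).add_right XZ_comm
theorem cZZs : Commute (ZZ : ER 𝕜 A) (XX + ZZ) := XZ_comm.symm.add_right (Commute.refl _)

theorem rx_pow {f : EL 𝕜 A} {g : ER 𝕜 A} (h : ∀ w, rx (f w) = g (rx w)) (k : ℕ)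
    (w : LS 𝕜 (LS 𝕜 A)) : rx ((f ^ k) w) = (g ^ k) (rx w) := mp_pow_comm rx f g h k w

theorem rz_pow {f : EL 𝕜 A} {g : ER 𝕜 A} (h : ∀ w, rz (f w) = g (rz w)) (k : ℕ)
    (w : LS 𝕜 (LS 𝕜 A)) : rz ((f ^ k) w) = (g ^ k) (rz w) := mp_pow_comm rz f g h k w

theorem rx_sum_pow (k : ℕ) (w : LS 𝕜 (LS 𝕜 A)) :
    rx (((Xi + Zo : EL 𝕜 A) ^ k) w) = ((XX + ZZ : ER 𝕜 A) ^ k) (rx w) :=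
  rx_pow (fun w => by rw [add_comm]; rfl) k w

theorem rz_sum_pow (k : ℕ) (w : LS 𝕜 (LS 𝕜 A)) :
    rz (((Xi + Zo : EL 𝕜 A) ^ k) w) = ((XX + ZZ : ER 𝕜 A) ^ k) (rz w) :=
  rz_pow (fun w => rfl) k w

theorem XX_pow_inj (k : ℕ) {F G : ℤ → ℤ → A} (h : ((XX : ER 𝕜 A) ^ k) F = ((XX : ER 𝕜 A) ^ k) G) :
    F = G := by
  funext m n
  have := congrFun (congrFun h (m + k)) n
  simpa [XX_pow] using this

theorem ZZ_pow_inj (k : ℕ) {F G : ℤ → ℤ → A} (h : ((ZZ : ER 𝕜 A) ^ k) F = ((ZZ : ER 𝕜 A) ^ k) G) :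
    F = G := by
  funext m n
  have := congrFun (congrFun h m) (n + k)
  simpa [ZZ_pow] using this

theorem loc1 (P Q R R' : LS 𝕜 (LS 𝕜 A)) (h1 : rz (EE der Q) = rx R')
    (h2 : R = EE der (ng R')) (h3 : rz (EE der P) = rx R) :
    ∃ K : ℕ, ((XX - ZZ : ER 𝕜 A) ^ K) (rz P) = ((XX - ZZ : ER 𝕜 A) ^ K) (rx Q) := by
  obtain ⟨N, hN⟩ := R'.2
  obtain ⟨N', hN'⟩ := (EE der Q).2
  set K := N.natAbs + N'.natAbs with hK
  have hb : ∀ m n : ℤ, (m < -K ∨ n < -K) → (R'.1 m).1 n = 0 := by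
    intro m n h
    rcases h with h | h
    · rw [hN m (by omega)]; rfl
    · have e1 : ((EE der Q).1 n).1 m = (R'.1 m).1 n := congrFun (congrFun h1 m) n
      rw [← e1, hN' n (by omega)]; rfl
  refine ⟨K, ?_⟩
  have key := quad_loc (((Xi - Zo : EL 𝕜 A) ^ K) ((Xi ^ K) P))
    (((Zo - Xi : EL 𝕜 A) ^ K) ((Zo ^ K) Q)) ((Zo ^ K) (((Xi + Zo : EL 𝕜 A) ^ K) R))
    (((-Zo : EL 𝕜 A) ^ K) ((Xi ^ K) R')) ?_ ?_ ?_ ?_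
  · rw [rz_pow (g := XX - ZZ) (fun w => rfl), rz_pow rz_Xi, rx_pow (g := XX - ZZ) (fun w => rfl),
      rx_pow rx_Zo] at key
    refine XX_pow_inj (𝕜 := 𝕜) K ?_
    rw [swapc cXXd K K (rz P), swapc cXXd K K (rx Q)]
    exact key
  · rw [T_sub_pow', T_Zo_pow, rz_pow (g := -XX) (fun w => rfl), rz_pow rz_Zo, h1,
      rx_pow (g := -XX) (fun w => rfl), rx_pow rx_Xi]
  · rw [mp_pow_comm ng (-Zo : EL 𝕜 A) Zo (fun w => by
      rw [LinearMap.neg_apply, map_neg, ng_Zo, LinearMap.neg_apply, neg_neg]),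
      mp_pow_comm ng (Xi : EL 𝕜 A) Xi ng_Xi, T_Zo_pow, T_Xi_pow, h2]
  · rw [T_sub_pow, T_Xi_pow, rz_pow rz_Xi, rz_sum_pow, h3, rx_pow rx_Zo, rx_sum_pow]
  · intro m n h
    change rx (((-Zo : EL 𝕜 A) ^ K) ((Xi ^ K) R')) m n = 0
    rw [rx_pow (g := -XX) (fun w => rfl), rx_pow rx_Xi, neg_pow_app]
    have e0 : ((XX : ER 𝕜 A) ^ K) (((ZZ : ER 𝕜 A) ^ K) (rx R')) m n = 0 := by
      rw [XX_pow, ZZ_pow]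
      exact hb _ _ (by omega)
    rw [Pi.smul_apply, Pi.smul_apply, e0, smul_zero]

theorem loc2 (P Q R R' : LS 𝕜 (LS 𝕜 A)) (l : ℕ)
    (h1 : ((XX + ZZ : ER 𝕜 A) ^ l) (rz (EE der Q)) = ((XX + ZZ : ER 𝕜 A) ^ l) (rx R'))
    (h2 : R = EE der (ng R'))
    (h3 : ((XX + ZZ : ER 𝕜 A) ^ l) (rz (EE der P)) = ((XX + ZZ : ER 𝕜 A) ^ l) (rx R)) :
    ∃ K : ℕ, ((XX - ZZ : ER 𝕜 A) ^ K) (rz P) = ((XX - ZZ : ER 𝕜 A) ^ K) (rx Q) := by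
  obtain ⟨K, hK⟩ := loc1 ((Zo ^ l) ((Xi ^ l) P)) ((Zo ^ l) ((Xi ^ l) Q))
    ((Xi ^ l) (((Xi + Zo : EL 𝕜 A) ^ l) R)) ((Xi ^ l) (((Xi + Zo : EL 𝕜 A) ^ l) R')) (by
      rw [T_Zo_pow, T_Xi_pow, rz_pow rz_Zo, rz_sum_pow, h1, rx_pow rx_Xi, rx_sum_pow]) (by
      rw [mp_pow_comm ng (Xi : EL 𝕜 A) Xi ng_Xi, mp_pow_comm ng (Xi + Zo : EL 𝕜 A) (Xi - Zo)
        (fun w => by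
          rw [LinearMap.add_apply, map_add, ng_Zo, ng_Xi, LinearMap.sub_apply,
            LinearMap.neg_apply, sub_eq_add_neg]), T_Xi_pow, T_sub_pow, h2, swapc cXs]) (by
      rw [T_Zo_pow, T_Xi_pow, rz_pow rz_Zo, rz_sum_pow, h3, rx_pow rx_Xi, rx_sum_pow])
  refine ⟨K, ?_⟩
  rw [rz_pow rz_Zo, rz_pow rz_Xi, rx_pow rx_Zo, rx_pow rx_Xi, swapc XZ_comm l l (rx Q)] at hK
  refine XX_pow_inj (𝕜 := 𝕜) l (ZZ_pow_inj (𝕜 := 𝕜) l ?_)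
  rw [swapc cXXd l K (rz P), swapc cXXd l K (rx Q), swapc cZZd l K,
    swapc cZZd l K (((XX : ER 𝕜 A) ^ l) (rx Q))]
  exact hK

theorem ptA (d : A →ₗ[𝕜] A) (W J : LS 𝕜 (LS 𝕜 A)) (h : rx W = rz J) :
    rx (mp (EE d) W) = rz (EE (mp d) J) := by
  funext m n
  have e : mp (evl m) J = W.1 m := LS.ext fun i => (congrFun (congrFun h m) i).symm
  have e2 := mp_EE (evl m) (mp d) d (fun _ => rfl) J
  rw [e] at e2
  exact (congrFun (congrArg LS.val e2) n).symm

theorem ptB (d : A →ₗ[𝕜] A) (W J : LS 𝕜 (LS 𝕜 A)) (h : rx W = rz J) :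
    rx (EE (mp d) W) = rz (mp (EE d) J) := by
  have h' : rx J = rz W := by
    funext m n
    exact (congrFun (congrFun h n) m).symm
  funext m n
  exact (congrFun (congrFun (ptA d J W h') n) m).symm

theorem sum_mpEE (d : A →ₗ[𝕜] A) (k : ℕ) (w : LS 𝕜 (LS 𝕜 A)) :
    mp (EE d) (((Xi + Zo : EL 𝕜 A) ^ k) w) = ((Xi + Zo : EL 𝕜 A) ^ k) (mp (EE d) w) := by
  refine mp_pow_comm (mp (EE d)) (Xi + Zo : EL 𝕜 A) (Xi + Zo : EL 𝕜 A) (fun w => ?_) k w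
  rw [LinearMap.add_apply, map_add, LinearMap.add_apply]
  congr 1
  apply LS.ext; intro n
  exact (sh_EE d (w.1 n)).symm

theorem sum_EEmp (d : A →ₗ[𝕜] A) (k : ℕ) (w : LS 𝕜 (LS 𝕜 A)) :
    EE (mp d) (((Xi + Zo : EL 𝕜 A) ^ k) w) = ((Xi + Zo : EL 𝕜 A) ^ k) (EE (mp d) w) := by
  refine mp_pow_comm (EE (mp d)) (Xi + Zo : EL 𝕜 A) (Xi + Zo : EL 𝕜 A) (fun w => ?_) k w
  rw [LinearMap.add_apply, map_add, LinearMap.add_apply]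
  congr 1
  · exact (mp_EE sh (mp d) (mp d) (fun _ => rfl) w).symm
  · exact (sh_EE _ w).symm

theorem ptA' (d : A →ₗ[𝕜] A) (W J : LS 𝕜 (LS 𝕜 A)) (k : ℕ)
    (h : ((XX + ZZ : ER 𝕜 A) ^ k) (rx W) = ((XX + ZZ : ER 𝕜 A) ^ k) (rz J)) :
    ((XX + ZZ : ER 𝕜 A) ^ k) (rx (mp (EE d) W)) =
      ((XX + ZZ : ER 𝕜 A) ^ k) (rz (EE (mp d) J)) := by
  rw [← rx_sum_pow, ← rz_sum_pow] at h ⊢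
  rw [← sum_mpEE, ← sum_EEmp]
  exact ptA d _ _ h

theorem ptB' (d : A →ₗ[𝕜] A) (W J : LS 𝕜 (LS 𝕜 A)) (k : ℕ)
    (h : ((XX + ZZ : ER 𝕜 A) ^ k) (rx W) = ((XX + ZZ : ER 𝕜 A) ^ k) (rz J)) :
    ((XX + ZZ : ER 𝕜 A) ^ k) (rx (EE (mp d) W)) =
      ((XX + ZZ : ER 𝕜 A) ^ k) (rz (mp (EE d) J)) := by
  rw [← rx_sum_pow, ← rz_sum_pow] at h ⊢
  rw [← sum_mpEE, ← sum_EEmp]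
  exact ptB d _ _ h

/-- negation of the second variable -/
def nu : ER 𝕜 A where
  toFun F := fun m n => ((n.negOnePow : ℤ)) • F m n
  map_add' _ _ := by funext m n; simp
  map_smul' c F := by
    funext m n
    simp only [Pi.smul_apply, RingHom.id_apply]
    rw [smul_comm]

/-- swap and negate both variables -/
def sg : ER 𝕜 A where
  toFun F := fun m n => ((m.negOnePow : ℤ)) • ((n.negOnePow : ℤ)) • F n m
  map_add' _ _ := by funext m n; simp
  map_smul' c F := by
    funext m n
    simp only [Pi.smul_apply, RingHom.id_apply]
    rw [smul_comm _ c, smul_comm _ c]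

theorem nu_rx (w : LS 𝕜 (LS 𝕜 A)) : nu (𝕜 := 𝕜) (rx w) = rx (mp ng w) := rfl
theorem nu_rz (w : LS 𝕜 (LS 𝕜 A)) : nu (𝕜 := 𝕜) (rz w) = rz (ng w) := rfl
theorem sg_rx (w : LS 𝕜 (LS 𝕜 A)) : sg (𝕜 := 𝕜) (rx w) = rz (mp ng (ng w)) := by
  funext m n
  rfl
theorem sg_rz (w : LS 𝕜 (LS 𝕜 A)) : sg (𝕜 := 𝕜) (rz w) = rx (mp ng (ng w)) := by
  funext m n
  change _ = (n.negOnePow : ℤ) • (m.negOnePow : ℤ) • (w.1 m).1 n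
  rw [smul_comm]
  rfl

theorem nu_pow (k : ℕ) (F : ℤ → ℤ → A) :
    nu (𝕜 := 𝕜) (((XX - ZZ : ER 𝕜 A) ^ k) F) = ((XX + ZZ : ER 𝕜 A) ^ k) (nu (𝕜 := 𝕜) F) := by
  refine mp_pow_comm nu (XX - ZZ : ER 𝕜 A) (XX + ZZ : ER 𝕜 A) (fun F => ?_) k F
  funext m n
  change (n.negOnePow : ℤ) • (F (m - 1) n - F m (n - 1)) =
    (n.negOnePow : ℤ) • F (m - 1) n + ((n - 1).negOnePow : ℤ) • F m (n - 1)
  rw [Int.negOnePow_sub]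
  simp [smul_sub, sub_eq_add_neg]

theorem sg_pow (k : ℕ) (F : ℤ → ℤ → A) :
    sg (𝕜 := 𝕜) (((XX + ZZ : ER 𝕜 A) ^ k) F) = ((-(XX + ZZ) : ER 𝕜 A) ^ k) (sg (𝕜 := 𝕜) F) := by
  refine mp_pow_comm sg (XX + ZZ : ER 𝕜 A) (-(XX + ZZ) : ER 𝕜 A) (fun F => ?_) k F
  funext m n
  change (m.negOnePow : ℤ) • (n.negOnePow : ℤ) • (F (n - 1) m + F n (m - 1)) =
    -(((m - 1).negOnePow : ℤ) • (n.negOnePow : ℤ) • F n (m - 1) +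
     (m.negOnePow : ℤ) • ((n - 1).negOnePow : ℤ) • F (n - 1) m)
  rw [Int.negOnePow_sub, Int.negOnePow_sub]
  simp [smul_add]

theorem sg_key (k : ℕ) (F G : ℤ → ℤ → A)
    (h : ((XX + ZZ : ER 𝕜 A) ^ k) F = ((XX + ZZ : ER 𝕜 A) ^ k) G) :
    ((XX + ZZ : ER 𝕜 A) ^ k) (sg (𝕜 := 𝕜) F) = ((XX + ZZ : ER 𝕜 A) ^ k) (sg (𝕜 := 𝕜) G) := by
  have h := congrArg (sg (𝕜 := 𝕜)) h
  rw [sg_pow, sg_pow, neg_pow_app, neg_pow_app] at h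
  have h := congrArg (fun H => ((-1 : ℤ) ^ k) • H) h
  simpa [smul_smul, ← mul_pow] using h

theorem piece3 (α γ : A →ₗ[𝕜] LS 𝕜 A) (d : A →ₗ[𝕜] A) (ρ : B →ₗ[𝕜] LS 𝕜 A) (D : B →ₗ[𝕜] B)
    (u : A) (p q : LS 𝕜 B) (hα : ∀ v, α (d v) = (mp d - der : Module.End 𝕜 (LS 𝕜 A)) (α v))
    (hρ : ∀ v, ρ (D v) = der (ρ v)) (hpq : p = EE D (ng q)) (l : ℕ)
    (h1 : ((XX + ZZ : ER 𝕜 A) ^ l) (rz (EE der (mp γ (α u)))) =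
      ((XX + ZZ : ER 𝕜 A) ^ l) (rx (mp ρ q)))
    (h3 : ((XX + ZZ : ER 𝕜 A) ^ l) (rz (EE der (mp α (γ u)))) =
      ((XX + ZZ : ER 𝕜 A) ^ l) (rx (mp ρ p))) :
    ∃ K : ℕ, ((XX + ZZ : ER 𝕜 A) ^ K) (rx (mp (EE d ∘ₗ ng ∘ₗ γ) (α u))) =
      ((XX + ZZ : ER 𝕜 A) ^ K) (rz (EE der (mp α (EE d (ng (γ u)))))) := by
  obtain ⟨K, hK⟩ := loc2 _ _ _ _ l h1 (by rw [hpq, mp_EE ρ D der hρ, mp_ng]) h3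
  refine ⟨K, ?_⟩
  have hK := congrArg (nu (𝕜 := 𝕜)) hK
  rw [nu_pow, nu_pow, nu_rx, nu_rz, ← mp_ng] at hK
  rw [mp_EE α d (mp d - der) hα, ← EE_add, add_sub_cancel]
  · exact ptA' d _ _ K hK.symm
  · refine Commute.sub_right ?_ (Commute.refl _)
    exact LinearMap.ext fun w => (mp_der d w).symm

theorem piece4 (β γ : A →ₗ[𝕜] LS 𝕜 A) (d : A →ₗ[𝕜] A) (ρ : B →ₗ[𝕜] LS 𝕜 A) (D : B →ₗ[𝕜] B)
    (u : A) (p q : LS 𝕜 B) (hγ : ∀ v, γ (d v) = (mp d - der : Module.End 𝕜 (LS 𝕜 A)) (γ v))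
    (hρ : ∀ v, ρ (D v) = der (ρ v)) (hpq : p = EE D (ng q)) (l : ℕ)
    (h : ((XX + ZZ : ER 𝕜 A) ^ l) (rx (mp ρ q)) =
      ((XX + ZZ : ER 𝕜 A) ^ l) (rz (EE der (mp γ (β u))))) :
    ((XX + ZZ : ER 𝕜 A) ^ l) (rx (mp (EE d ∘ₗ ng ∘ₗ γ) (EE d (ng (β u))))) =
      ((XX + ZZ : ER 𝕜 A) ^ l) (rz (EE der (mp (EE d ∘ₗ ng ∘ₗ ρ) p))) := by
  have hc : Commute (mp d : Module.End 𝕜 (LS 𝕜 A)) der := LinearMap.ext fun w => mp_der d w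
  have h' := sg_key l _ _ h
  rw [sg_rx, sg_rz, ng_EE, mp_EE ng (-der) der (fun a => by
    rw [der_ng, LinearMap.neg_apply, map_neg])] at h'
  have e1 : mp (EE d ∘ₗ ng ∘ₗ γ) (EE d (ng (β u))) =
      mp (EE d) (EE (mp d) (EE der (mp ng (ng (mp γ (β u)))))) := by
    rw [← EE_add _ _ hc, ← mp_ng, mp_comp, ← mp_EE (ng ∘ₗ γ) d (mp d + der)]
    · rfl
    · intro a
      change ng (γ (d a)) = mp d (ng (γ a)) + der (ng (γ a))
      rw [hγ, LinearMap.sub_apply, map_sub, der_ng, mp_ng, sub_eq_add_neg]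
  have e2 : EE der (mp (EE d ∘ₗ ng ∘ₗ ρ) p) =
      EE (mp d) (mp (EE d) (mp ng (ng (mp ρ q)))) := by
    rw [hpq]
    have e3 : mp (EE d ∘ₗ ng ∘ₗ ρ) (EE D (ng q)) =
        mp (EE d) (EE (-der) (mp ng (ng (mp ρ q)))) := by
      rw [← mp_ng, mp_comp, ← mp_EE (ng ∘ₗ ρ) D (-der)]
      · rfl
      · intro a
        change ng (ρ (D a)) = - der (ng (ρ a))
        rw [hρ, der_ng, neg_neg]
    rw [e3, ← mp_EE (EE d) (mp d + der) der (fun a => by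
      rw [der_EE, LinearMap.add_apply, add_comm]), EE_add _ _ hc, EE_EE_neg,
      mp_EE (EE d) (mp d) (mp d) (fun a => (mp_EE d d d (fun _ => rfl) a).symm)]
  rw [e1, e2]
  exact ptA' d _ _ l (ptB' d _ _ l h'.symm)

/-- bundling -/
def mkL (F : B → ℤ → A) (h1 : ∀ n, IsLinearMap 𝕜 (fun b => F b n))
    (h2 : ∀ b, ∃ N : ℤ, ∀ n < N, F b n = 0) : B →ₗ[𝕜] LS 𝕜 A where
  toFun b := ⟨F b, h2 b⟩
  map_add' x y := LS.ext fun n => (h1 n).map_add x y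
  map_smul' c x := LS.ext fun n => (h1 n).map_smul c x

theorem pow_mono {F G : ℤ → ℤ → A} {k : ℕ} (j : ℕ) (hj : k ≤ j)
    (h : ((XX + ZZ : ER 𝕜 A) ^ k) F = ((XX + ZZ : ER 𝕜 A) ^ k) G) :
    ((XX + ZZ : ER 𝕜 A) ^ j) F = ((XX + ZZ : ER 𝕜 A) ^ j) G := by
  obtain ⟨i, rfl⟩ := Nat.exists_eq_add_of_le' hj
  rw [pow_add, Module.End.mul_apply, Module.End.mul_apply, h]

/-- raw coefficientwise map -/
def rawmap (g : B →ₗ[𝕜] A) : (ℤ → ℤ → B) →ₗ[𝕜] (ℤ → ℤ → A) where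
  toFun F := fun m n => g (F m n)
  map_add' _ _ := by funext m n; simp
  map_smul' c F := by funext m n; simp

theorem rawmap_pow (g : B →ₗ[𝕜] A) (k : ℕ) (F : ℤ → ℤ → B) :
    rawmap g (((XX + ZZ : ER 𝕜 B) ^ k) F) = ((XX + ZZ : ER 𝕜 A) ^ k) (rawmap g F) := by
  induction k generalizing F with
  | zero => rfl
  | succ k ih =>
    rw [pow_succ, pow_succ, Module.End.mul_apply, Module.End.mul_apply, ih]
    congr 1
    funext m n
    exact map_add g _ _

theorem piece2 (g : B →ₗ[𝕜] A) (W J : LS 𝕜 (LS 𝕜 B)) (k : ℕ)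
    (h : ((XX + ZZ : ER 𝕜 B) ^ k) (rx W) = ((XX + ZZ : ER 𝕜 B) ^ k) (rz (EE der J))) :
    ((XX + ZZ : ER 𝕜 A) ^ k) (rx (mp (mp g) W)) =
      ((XX + ZZ : ER 𝕜 A) ^ k) (rz (EE der (mp (mp g) J))) := by
  have h := congrArg (rawmap g) h
  rw [rawmap_pow, rawmap_pow] at h
  rw [← mp_EE (mp g) der der (mp_der g)]
  exact h

end Aux



variable (𝕜 : Type*) [Field 𝕜] [CharZero 𝕜]
  {V M : Type*} [AddCommGroup V] [Module 𝕜 V] [AddCommGroup M] [Module 𝕜 M]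
  (Y : V → V → ℤ → V) (one : V) (D : V →ₗ[𝕜] V)
  (YM : V → M → ℤ → M) (d : M →ₗ[𝕜] M)

/-- for `g ∈ C¹(V,M)`, `f := δ₁ g` satisfies the 2-cocycle condition;
hence `Im δ₁ ⊆ Z²(V,M)`. -/
theorem delta1_cocycle
    (hV : IsVertexAlg 𝕜 Y one D) (hM : IsVModule 𝕜 Y one D YM d)
    (g : V →ₗ[𝕜] M) (hgD : ∀ a, g (D a) = d (g a)) (hg1 : g one = 0) :
    Cocycle 𝕜 Y YM d (fun a b => delta1 𝕜 Y YM d g a b) := by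
  let Yl : V → V →ₗ[𝕜] LS 𝕜 V := fun a => mkL (Y a) (hV.linear_right a) (hV.trunc a)
  let Yr : V → V →ₗ[𝕜] LS 𝕜 V := fun c =>
    mkL (fun a => Y a c) (hV.linear_left c) (fun a => hV.trunc a c)
  let Ml : V → M →ₗ[𝕜] LS 𝕜 M := fun a => mkL (YM a) (hM.linear_right a) (hM.trunc a)
  let Mr : M → V →ₗ[𝕜] LS 𝕜 M := fun u =>
    mkL (fun a => YM a u) (hM.linear_left u) (fun a => hM.trunc a u)
  have hMr : ∀ u v, Mr u (D v) = der (Mr u v) := fun u v =>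
    LS.ext fun n => congrFun (hM.transl v u) n
  have hMl : ∀ a v, Ml a (d v) = (mp d - der : Module.End 𝕜 (LS 𝕜 M)) (Ml a v) := by
    intro a v
    apply LS.ext
    intro n
    have h1 := hM.derivation a v n
    rw [hM.transl] at h1
    change YM a (d v) n = d (YM a v n) - derivz (YM a v) n
    rw [h1, add_sub_cancel_left]
  have hcomm : ∀ a b, Yl a b = EE D (ng (Yl b a)) := fun a b =>
    LS.ext fun n => congrFun (hV.comm a b) n
  have hMassoc : ∀ a b u, ∃ l : ℕ, ((XX + ZZ : ER 𝕜 M) ^ l) (rx (mp (Mr u) (Yl a b))) =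
      ((XX + ZZ : ER 𝕜 M) ^ l) (rz (EE der (mp (Ml a) (Ml b u)))) := by
    intro a b u
    obtain ⟨l, hl⟩ := hM.assoc a b u
    refine ⟨l, ?_⟩
    rw [mulZW_eq (𝕜 := 𝕜), mulZW_eq (𝕜 := 𝕜)] at hl
    rw [← shiftComp_eq YM a (Ml a) (fun _ => rfl) (Ml b u)]
    exact hl
  have hVassoc : ∀ a b c, ∃ l : ℕ, ((XX + ZZ : ER 𝕜 V) ^ l) (rx (mp (Yr c) (Yl a b))) =
      ((XX + ZZ : ER 𝕜 V) ^ l) (rz (EE der (mp (Yl a) (Yl b c)))) := by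
    intro a b c
    obtain ⟨l, hl⟩ := hV.assoc a b c
    refine ⟨l, ?_⟩
    rw [mulZW_eq (𝕜 := 𝕜), mulZW_eq (𝕜 := 𝕜)] at hl
    rw [← shiftComp_eq Y a (Yl a) (fun _ => rfl) (Yl b c)]
    exact hl
  intro a b c
  obtain ⟨l1, e1⟩ := hMassoc a b (g c)
  obtain ⟨l2, e2⟩ := hVassoc a b c
  have e2 := piece2 g _ _ _ e2
  obtain ⟨l3, e3⟩ := hMassoc c a (g b)
  obtain ⟨l4, e4⟩ := hMassoc a c (g b)
  obtain ⟨l5, e5⟩ := piece3 (Ml a) (Ml c) d (Mr (g b)) D (g b) (Yl a c) (Yl c a) (hMl a)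
    (hMr _) (hcomm a c) (l3 + l4) (pow_mono _ (by omega) e3.symm) (pow_mono _ (by omega) e4.symm)
  obtain ⟨l6, e6⟩ := hMassoc c b (g a)
  have e6 := piece4 (Ml b) (Ml c) d (Mr (g a)) D (g a) (Yl b c) (Yl c b) (hMl c)
    (hMr _) (hcomm b c) l6 e6
  refine ⟨l1 + l2 + l5 + l6, ?_⟩
  replace e1 := pow_mono (l1 + l2 + l5 + l6) (by omega) e1
  replace e2 := pow_mono (l1 + l2 + l5 + l6) (by omega) e2
  replace e5 := pow_mono (l1 + l2 + l5 + l6) (by omega) e5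
  replace e6 := pow_mono (l1 + l2 + l5 + l6) (by omega) e6
  rw [mulZW_eq (𝕜 := 𝕜), mulZW_eq (𝕜 := 𝕜)]
  -- the series `f_z(b,c)` and the map `f_z(a, ·)`
  let fl : V → V →ₗ[𝕜] LS 𝕜 M := fun a => Ml a ∘ₗ g - mp g ∘ₗ Yl a + EE d ∘ₗ ng ∘ₗ Mr (g a)
  have hfl : ∀ a b, (fl a b).1 = delta1 𝕜 Y YM d g a b := fun _ _ => rfl
  let R : V → M →ₗ[𝕜] LS 𝕜 M := fun c => EE d ∘ₗ ng ∘ₗ Ml c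
  have hR : ∀ c u, (R c u).1 = rAct 𝕜 YM d u c := fun _ _ => rfl
  have hL : (fun m n => delta1 𝕜 Y YM d g (Y a b m) c n +
      rAct 𝕜 YM d (delta1 𝕜 Y YM d g a b m) c n) =
      rx (mp (Mr (g c)) (Yl a b)) - rx (mp (mp g) (mp (Yr c) (Yl a b))) +
        rx (mp (R c) (Ml a (g b))) + rx (mp (R c) (EE d (ng (Ml b (g a))))) := by
    funext m n
    have h1 : (R c (delta1 𝕜 Y YM d g a b m)).1 n = (R c (YM a (g b) m)).1 n -
        (R c (g (Y a b m))).1 n + (R c (rAct 𝕜 YM d (g a) b m)).1 n := by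
      rw [show delta1 𝕜 Y YM d g a b m = YM a (g b) m - g (Y a b m) + rAct 𝕜 YM d (g a) b m
        from rfl, map_add, map_sub]
      rfl
    rw [← hR, h1]
    change (YM (Y a b m) (g c) n - g (Y (Y a b m) c n) + (R c (g (Y a b m))).1 n) + _ =
      YM (Y a b m) (g c) n - g (Y (Y a b m) c n) + (R c (YM a (g b) m)).1 n +
        (R c (rAct 𝕜 YM d (g a) b m)).1 n
    abel
  have hRt : (fun m n => shiftComp YM a (delta1 𝕜 Y YM d g b c) m n +
      shiftComp (fun a b => delta1 𝕜 Y YM d g a b) a (Y b c) m n) =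
      rz (EE der (mp (Ml a) (Ml b (g c)))) - rz (EE der (mp (mp g) (mp (Yl a) (Yl b c)))) +
        rz (EE der (mp (Ml a) (EE d (ng (Ml c (g b)))))) +
        rz (EE der (mp (EE d ∘ₗ ng ∘ₗ Mr (g a)) (Yl b c))) := by
    have h1 := shiftComp_eq YM a (Ml a) (fun _ => rfl) (fl b c)
    have h2 := shiftComp_eq (fun a b => delta1 𝕜 Y YM d g a b) a (fl a) (hfl a) (Yl b c)
    have h3 : mp (Ml a) (fl b c) = mp (Ml a) (Ml b (g c)) - mp (Ml a ∘ₗ g) (Yl b c) +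
        mp (Ml a) (EE d (ng (Ml c (g b)))) := by
      rw [← mp_comp, ← map_sub, ← map_add]
      rfl
    have h4 : mp (fl a) (Yl b c) = mp (Ml a ∘ₗ g) (Yl b c) - mp (mp g) (mp (Yl a) (Yl b c)) +
        mp (EE d ∘ₗ ng ∘ₗ Mr (g a)) (Yl b c) := rfl
    rw [h3] at h1
    rw [h4] at h2
    simp only [map_add, map_sub] at h1 h2
    have h5 := congrArg₂ (fun F G => F + G) h1 h2
    refine Eq.trans h5 ?_
    abel
  rw [hL, hRt]
  simp only [map_add, map_sub]
  rw [e1, e2, e6]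
  congr 2

end VertexCohomology
end

section
/- Let $V$ be a vertex algebra, $M$ a $V$-module, and $\psi \in C^2(V,M)$. Define on $V \oplus M$ the product $(a,u)\,{}_z\,(b,v) = (a\,{}_z\, b,\ a\,{}_z\, v + u\,{}_z\, b + \psi_z(a,b))$. Then $(V \oplus M, {}_z, (\mathbf{1},0), D \oplus d)$ is a vertex algebra if and only if $\psi \in Z^2(V,M)$, i.e. if and only if for all $a,b,c \in V$ there exists $n$ with $(x+z)^n[\psi_z(a\,{}_x\, b,c) + \psi_x(a,b)\,{}_z\, c] = (x+z)^n[a\,{}_{x+z}\,\psi_z(b,c) + \psi_{x+z}(a, b\,{}_z\, c)]$. -/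
/- Coefficient-wise formalization of vertex algebras:
a series `w ∈ V((z))` is encoded by its coefficient function `ℤ → V`
(the value at `n` being the coefficient of `z^n`), and a field/product
`a ⊗ b ↦ a_z b ∈ V((z))` by a map `V → V → ℤ → V`. -/

namespace VertexCohomology

open scoped BigOperators

section Helpers

theorem finsupp_of_le {M : Type*} [Zero M] {f : ℕ → M} (K : ℕ) (h : ∀ k, K ≤ k → f k = 0) :
    (Function.support f).Finite := by
  apply (Set.finite_lt_nat K).subset
  intro k hk
  by_contra hc
  exact hk (h k (not_lt.mp hc))

theorem finsum_eq_range {M : Type*} [AddCommMonoid M] {f : ℕ → M} (K : ℕ)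
    (h : ∀ k, K ≤ k → f k = 0) : ∑ᶠ k, f k = ∑ k ∈ Finset.range K, f k := by
  apply finsum_eq_sum_of_support_subset
  intro k hk
  by_contra hc
  exact hk (h k (by simpa using hc))

theorem finsum_single {M : Type*} [AddCommMonoid M] {f : ℕ → M}
    (h : ∀ k, k ≠ 0 → f k = 0) : ∑ᶠ k, f k = f 0 := by
  rw [finsum_eq_range 1 (fun k hk => h k (by omega))]; simp

theorem finsum_succ {M : Type*} [AddCommMonoid M] {f : ℕ → M} (K : ℕ)
    (h : ∀ k, K ≤ k → f k = 0) : ∑ᶠ k, f k = f 0 + ∑ᶠ k, f (k + 1) := by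
  rw [finsum_eq_range (K + 1) (fun k hk => h k (by omega)),
    finsum_eq_range K (fun k hk => h (k + 1) (by omega)), Finset.sum_range_succ', add_comm]

theorem finsum_antidiag {M : Type*} [AddCommMonoid M] {g : ℕ → ℕ → M} (K : ℕ)
    (h : ∀ i j, K ≤ i + j → g i j = 0) :
    ∑ᶠ i, ∑ᶠ j, g i j = ∑ᶠ s : ℕ, ∑ p ∈ Finset.HasAntidiagonal.antidiagonal s, g p.1 p.2 := by
  have h1 : ∀ i, ∑ᶠ j, g i j = ∑ j ∈ Finset.range K, g i j := fun i =>
    finsum_eq_range K (fun j hj => h i j (by omega))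
  simp_rw [h1]
  rw [finsum_eq_range K (fun i hi => Finset.sum_eq_zero (fun j _ => h i j (by omega))),
    finsum_eq_range K (fun s hs => Finset.sum_eq_zero (fun p hp => h _ _ (by
      have := Finset.HasAntidiagonal.mem_antidiagonal.mp hp; omega)))]
  rw [← Finset.sum_product', Finset.sum_sigma']
  symm
  apply Finset.sum_of_injOn (fun x => x.2)
  · rintro ⟨s, p⟩ hp ⟨s', p'⟩ hp' heq
    simp only [Finset.coe_sigma, Set.mem_sigma_iff, Finset.mem_coe, Finset.mem_range, Finset.HasAntidiagonal.mem_antidiagonal] at hp hp' heq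
    subst heq
    obtain ⟨_, rfl⟩ := hp
    obtain ⟨_, rfl⟩ := hp'
    rfl
  · rintro ⟨s, p⟩ hp
    simp only [Finset.coe_sigma, Set.mem_sigma_iff, Finset.mem_coe, Finset.mem_range, Finset.HasAntidiagonal.mem_antidiagonal, Finset.mem_product] at hp ⊢
    omega
  · rintro ⟨i, j⟩ _ hn
    apply h
    by_contra hc
    apply hn
    refine ⟨⟨i + j, (i, j)⟩, ?_, rfl⟩
    simp only [Finset.coe_sigma, Set.mem_sigma_iff, Finset.mem_coe, Finset.mem_range, Finset.HasAntidiagonal.mem_antidiagonal]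
    exact ⟨not_le.mp hc, trivial⟩
  · intros; rfl

/-- Pascal-type recombination of sums. -/
theorem finsum_pascal {M : Type*} [AddCommGroup M] (α β γ : ℕ → ℤ) (g : ℕ → M) (K : ℕ)
    (h : ∀ k, K ≤ k → g k = 0) (h0 : α 0 = β 0) (hs : ∀ j, α (j + 1) = β (j + 1) + γ j) :
    ∑ᶠ j, α j • g j = ∑ᶠ j, β j • g j + ∑ᶠ j, γ j • g (j + 1) := by
  rw [finsum_succ K (f := fun j => α j • g j) (fun k hk => by simp [h k hk]),
    finsum_succ K (f := fun j => β j • g j) (fun k hk => by simp [h k hk]), add_assoc,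
    ← finsum_add_distrib (finsupp_of_le K (fun k hk => by simp [h (k+1) (by omega)]))
      (finsupp_of_le K (fun k hk => by simp [h (k+1) (by omega)]))]
  simp only [h0, hs, add_smul]

/-- the sign `(-1)^n` -/
def eps (n : ℤ) : ℤ := (n.negOnePow : ℤ)

theorem eps_add (m n : ℤ) : eps (m + n) = eps m * eps n := by simp [eps, Int.negOnePow_add]
theorem eps_sub (m n : ℤ) : eps (m - n) = eps m * eps n := by simp [eps, Int.negOnePow_sub]
theorem eps_neg (m : ℤ) : eps (-m) = eps m := by simp [eps]
theorem eps_zero : eps 0 = 1 := by simp [eps]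
theorem eps_one : eps 1 = -1 := by simp [eps]
theorem eps_mul_self (m : ℤ) : eps m * eps m = 1 := by
  rw [← eps_sub, sub_self, eps_zero]
theorem eps_nat (k : ℕ) : eps k = (-1) ^ k := by
  induction k with
  | zero => simp [eps_zero]
  | succ k ih => push_cast; rw [eps_add, ih, eps_one, pow_succ]

theorem negz_apply {M : Type*} [AddCommGroup M] (w : ℤ → M) (n : ℤ) :
    negz w n = eps n • w n := rfl

theorem ring_choose_neg (n : ℤ) (k : ℕ) :
    Ring.choose (-n - 1) k = eps k * Ring.choose (n + k) k := by
  have := Ring.choose_neg (n + 1) k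
  rw [show -n - 1 = -(n + 1) by ring, this, show n + 1 + k - 1 = n + k by ring, Units.smul_def]
  rfl

theorem ring_choose_mul (n : ℤ) (k : ℕ) :
    (k + 1) * Ring.choose (n + 1) (k + 1) = (n + 1) * Ring.choose n k := by
  have := Ring.choose_smul_choose (n + 1) (n := k + 1) (k := 1) (by omega)
  simpa using this

/-- lower truncated series -/
def Tr {M : Type*} [Zero M] (w : ℤ → M) : Prop := ∃ N : ℤ, ∀ n < N, w n = 0

section mulZW
variable {M : Type*} [AddCommGroup M]

theorem mulZW_zero (F : ℤ → ℤ → M) : mulZW 0 F = F := by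
  funext m n; simp [mulZW]

theorem mulZW_succ (l : ℕ) (F : ℤ → ℤ → M) (m n : ℤ) :
    mulZW (l + 1) F m n = mulZW l F (m - 1) n + mulZW l F m (n - 1) := by
  unfold mulZW
  rw [Finset.sum_range_succ']
  simp only [Nat.choose_succ_succ, Nat.cast_add, add_smul, Finset.sum_add_distrib]
  rw [add_comm (∑ x ∈ _, _) (∑ x ∈ _, _), add_right_comm]
  congr 1
  · rw [Finset.sum_range_succ, Finset.sum_range_succ' _ l]
    simp only [Nat.choose_succ_self, Nat.cast_zero, zero_smul, add_zero]
    congr 1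
    · apply Finset.sum_congr rfl
      intro k hk
      have := Finset.mem_range.mp hk
      congr 2
      omega
    · simp; congr 1; ring
  · apply Finset.sum_congr rfl
    intro k hk
    congr 2
    · omega
    · push_cast; ring

theorem mulZW_rec (R : ℕ → ℤ → ℤ → M)
    (h : ∀ r m n, R (r + 1) m n = R r (m - 1) n + R r m (n - 1)) (l : ℕ) :
    R l = mulZW l (R 0) := by
  induction l with
  | zero => rw [mulZW_zero]
  | succ l ih => funext m n; rw [h, mulZW_succ, ih]

theorem mulZW_mono {F G : ℤ → ℤ → M} {l l' : ℕ} (hl : l ≤ l') (h : mulZW l F = mulZW l G) :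
    mulZW l' F = mulZW l' G := by
  induction hl with
  | refl => exact h
  | step _ ih => funext m n; rw [mulZW_succ, mulZW_succ, ih]

theorem mulZW_add (l : ℕ) (F G : ℤ → ℤ → M) :
    mulZW l (fun m n => F m n + G m n) = fun m n => mulZW l F m n + mulZW l G m n := by
  funext m n
  simp [mulZW, Finset.sum_add_distrib]

theorem mulZW_swap (l : ℕ) (F : ℤ → ℤ → M) :
    mulZW l (fun m n => F n m) = fun m n => mulZW l F n m := by
  symm
  have := mulZW_rec (fun l m n => mulZW l F n m)
    (fun r m n => by rw [mulZW_succ, add_comm]) l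
  rw [this]; simp only [mulZW_zero]

theorem mulZW_eps (l : ℕ) (F : ℤ → ℤ → M) :
    mulZW l (fun m n => eps (m + n) • F m n) = fun m n => (eps l * eps (m + n)) • mulZW l F m n := by
  symm
  have := mulZW_rec (fun l m n => (eps l * eps (m + n)) • mulZW l F m n)
    (fun r m n => by
      simp only [mulZW_succ, smul_add]
      push_cast
      simp only [eps_add, eps_sub, eps_one]
      congr 2 <;> ring) l
  rw [this]; simp [mulZW_zero, eps_zero]

end mulZW


set_option linter.unusedSectionVars false

section Ezd
variable {𝕜 : Type*} [Field 𝕜] [CharZero 𝕜]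
variable {V W M : Type*} [AddCommGroup V] [AddCommGroup W] [Module 𝕜 W]
  [AddCommGroup M] [Module 𝕜 M]

theorem ezd_term_zero (d : M →ₗ[𝕜] M) {w : ℤ → M} {N : ℤ} (hw : ∀ n < N, w n = 0) (n : ℤ)
    (k : ℕ) (hk : (n - N + 1).toNat ≤ k) :
    ((k.factorial : 𝕜)⁻¹) • (d ^ k) (w (n - (k : ℤ))) = 0 := by
  rw [hw _ (by omega)]; simp

theorem ezd_supp (d : M →ₗ[𝕜] M) {w : ℤ → M} (hw : Tr w) (n : ℤ) :
    (Function.support fun k : ℕ => ((k.factorial : 𝕜)⁻¹) • (d ^ k) (w (n - (k : ℤ)))).Finite := by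
  obtain ⟨N, hN⟩ := hw
  exact finsupp_of_le _ (ezd_term_zero d hN n)

theorem ezd_add (d : M →ₗ[𝕜] M) {w w' : ℤ → M} (hw : Tr w) (hw' : Tr w') :
    ezd 𝕜 d (fun n => w n + w' n) = fun n => ezd 𝕜 d w n + ezd 𝕜 d w' n := by
  funext n
  unfold ezd
  rw [← finsum_add_distrib (ezd_supp d hw n) (ezd_supp d hw' n)]
  simp only [map_add, smul_add]

theorem ezd_lin (d : M →ₗ[𝕜] M) {w : ℤ → M} (f : M →ₗ[𝕜] M) (hf : ∀ u, d (f u) = f (d u))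
    (hw : Tr w) : ezd 𝕜 d (fun n => f (w n)) = fun n => f (ezd 𝕜 d w n) := by
  funext n
  unfold ezd
  have := f.toAddMonoidHom.map_finsum (ezd_supp d hw n)
  simp only [LinearMap.toAddMonoidHom_coe] at this
  rw [this]
  apply finsum_congr
  intro k
  rw [map_smul]
  congr 1
  show (d ^ k) (f (w (n - k))) = f ((d ^ k) (w (n - k)))
  generalize w (n - k) = u
  induction k generalizing u with
  | zero => simp
  | succ k ih => simp only [pow_succ, Module.End.mul_apply, hf, ih]

theorem ezd_smul (d : M →ₗ[𝕜] M) {w : ℤ → M} (c : 𝕜) (hw : Tr w) :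
    ezd 𝕜 d (fun n => c • w n) = fun n => c • ezd 𝕜 d w n :=
  ezd_lin d (c • LinearMap.id) (fun u => by simp) hw

theorem ezd_zsmul (d : M →ₗ[𝕜] M) {w : ℤ → M} (c : ℤ) (hw : Tr w) :
    ezd 𝕜 d (fun n => c • w n) = fun n => c • ezd 𝕜 d w n :=
  ezd_lin d (c • LinearMap.id) (fun u => by simp) hw

theorem ezd_tr (d : M →ₗ[𝕜] M) {w : ℤ → M} {N : ℤ} (hw : ∀ n < N, w n = 0) :
    ∀ n < N, ezd 𝕜 d w n = 0 := by
  intro n hn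
  unfold ezd
  rw [← finsum_zero (α := ℕ)]
  apply finsum_congr
  intro k
  rw [hw _ (by omega)]; simp

theorem ezd_zero (d : M →ₗ[𝕜] M) (n : ℤ) : ezd 𝕜 d (fun _ => 0) n = 0 :=
  ezd_tr d (N := n + 1) (fun _ _ => rfl) n (by omega)

theorem ezd_Tr (d : M →ₗ[𝕜] M) {w : ℤ → M} (hw : Tr w) : Tr (ezd 𝕜 d w) := by
  obtain ⟨N, hN⟩ := hw
  exact ⟨N, ezd_tr d hN⟩

theorem negz_Tr {w : ℤ → M} (hw : Tr w) : Tr (negz w) := by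
  obtain ⟨N, hN⟩ := hw
  exact ⟨N, fun n hn => by rw [negz_apply, hN n hn, smul_zero]⟩

theorem negz_ezd (d : M →ₗ[𝕜] M) {w : ℤ → M} (hw : Tr w) :
    negz (ezd 𝕜 d (negz w)) = ezd 𝕜 (-d) w := by
  funext n
  rw [negz_apply]
  unfold ezd
  rw [smul_finsum']
  · apply finsum_congr
    intro k
    rw [negz_apply, map_zsmul, eps_sub, smul_comm, smul_smul, ← mul_assoc, eps_mul_self, one_mul,
      eps_nat]
    rcases Nat.even_or_odd k with h | h
    · simp [h.neg_one_pow, h.neg_pow]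
    · simp [h.neg_one_pow, h.neg_pow]
  · exact ezd_supp d (negz_Tr hw) n

/-- the divided Leibniz rule -/
theorem leibniz (G : W → ℤ → M) (e : W →ₗ[𝕜] W) (d : M →ₗ[𝕜] M)
    (hG : ∀ u m, d (G u m) = (m + 1) • G u (m + 1) + G (e u) m) (s : ℕ) (u : W) (m : ℤ) :
    ((s.factorial : 𝕜)⁻¹) • (d ^ s) (G u m) =
      ∑ p ∈ Finset.HasAntidiagonal.antidiagonal s, Ring.choose (m + (p.1 : ℤ)) p.1 •
        ((p.2.factorial : 𝕜)⁻¹) • G ((e ^ p.2) u) (m + (p.1 : ℤ)) := by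
  induction s with
  | zero => simp
  | succ s ih =>
    have hs : ((s : 𝕜) + 1) ≠ 0 := by exact_mod_cast Nat.succ_ne_zero s
    have h1 : (((s + 1).factorial : 𝕜)⁻¹) • (d ^ (s + 1)) (G u m)
        = ((s : 𝕜) + 1)⁻¹ • d (((s.factorial : 𝕜)⁻¹) • (d ^ s) (G u m)) := by
      rw [pow_succ', Module.End.mul_apply, map_smul, smul_smul, Nat.factorial_succ]
      push_cast
      rw [mul_inv]
    rw [h1, ih, inv_smul_eq_iff₀ hs, map_sum, Finset.smul_sum]
    set h : ℕ × ℕ → M := fun p => Ring.choose (m + (p.1 : ℤ)) p.1 •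
        ((p.2.factorial : 𝕜)⁻¹) • G ((e ^ p.2) u) (m + (p.1 : ℤ)) with hh
    have h2 : ∑ p ∈ Finset.HasAntidiagonal.antidiagonal (s + 1), ((s : 𝕜) + 1) • h p
        = ∑ p ∈ Finset.HasAntidiagonal.antidiagonal (s + 1), p.1 • h p
          + ∑ p ∈ Finset.HasAntidiagonal.antidiagonal (s + 1), p.2 • h p := by
      rw [← Finset.sum_add_distrib]
      apply Finset.sum_congr rfl
      intro p hp
      rw [← add_smul, Finset.HasAntidiagonal.mem_antidiagonal.mp hp]
      rw [← Nat.cast_smul_eq_nsmul 𝕜]; push_cast; rfl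
    rw [h2, Finset.Nat.sum_antidiagonal_succ (f := fun p => p.1 • h p),
      Finset.Nat.sum_antidiagonal_succ' (f := fun p => p.2 • h p)]
    simp only [zero_smul, zero_add]
    rw [← Finset.sum_add_distrib]
    apply Finset.sum_congr rfl
    rintro ⟨i, k⟩ _
    simp only [hh, map_zsmul, map_smul, hG, smul_add]
    congr 1
    · rw [smul_comm ((k.factorial : 𝕜)⁻¹) (m + (i : ℤ) + 1), smul_smul, ← natCast_zsmul, smul_smul]
      push_cast
      rw [← add_assoc m, ring_choose_mul, mul_comm]
    · rw [← Module.End.mul_apply, ← pow_succ', smul_comm (k + 1)]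
      congr 1
      rw [← Nat.cast_smul_eq_nsmul 𝕜, smul_smul, Nat.factorial_succ]
      push_cast
      rw [mul_inv, ← mul_assoc, mul_inv_cancel₀ (by exact_mod_cast Nat.succ_ne_zero k), one_mul]

theorem shiftComp_ezd (F : V → W → ℤ → M) (a : V) (e : W →ₗ[𝕜] W) (d : M →ₗ[𝕜] M)
    (lin : ∀ m, IsLinearMap 𝕜 (fun u => F a u m))
    (hF : ∀ u m, d (F a u m) = (m + 1) • F a u (m + 1) + F a (e u) m)
    {w : ℤ → W} (hw : Tr w) (m n : ℤ) :
    shiftComp F a (ezd 𝕜 e w) m n = ezd 𝕜 d (fun n' => F a (w n') m) n := by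
  obtain ⟨N, hN⟩ := hw
  have hw : Tr w := ⟨N, hN⟩
  have h1 : ∀ i : ℕ, Ring.choose (m + (i : ℤ)) i • F a (ezd 𝕜 e w (n - i)) (m + i)
      = ∑ᶠ k : ℕ, Ring.choose (m + (i : ℤ)) i • ((k.factorial : 𝕜)⁻¹) •
          F a ((e ^ k) (w (n - i - k))) (m + i) := by
    intro i
    let f : W →ₗ[𝕜] M := Ring.choose (m + (i : ℤ)) i • (lin (m + i)).mk'
    have := f.toAddMonoidHom.map_finsum (ezd_supp e hw (n - i))
    refine Eq.trans this ?_
    apply finsum_congr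
    intro k
    change f _ = _
    rw [map_smul, smul_comm]; rfl
  unfold shiftComp
  simp_rw [h1]
  rw [finsum_antidiag (n - N + 1).toNat]
  · unfold ezd
    apply finsum_congr
    intro s
    rw [leibniz (fun u m => F a u m) e d hF]
    apply Finset.sum_congr rfl
    intro p hp
    have := Finset.HasAntidiagonal.mem_antidiagonal.mp hp
    rw [show n - (p.1 : ℤ) - p.2 = n - s by omega]
  · intro i k hik
    rw [hN _ (by omega), map_zero, (lin _).map_zero, smul_zero, smul_zero]

theorem ezd_neg_ezd (d : M →ₗ[𝕜] M) {w : ℤ → M} (hw : Tr w) :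
    ezd 𝕜 (-d) (ezd 𝕜 d w) = w := by
  funext n
  let F : Unit → M → ℤ → M := fun _ u m =>
    if 0 ≤ m then ((m.toNat.factorial : 𝕜)⁻¹) • ((-d) ^ m.toNat) u else 0
  have h := shiftComp_ezd (𝕜 := 𝕜) F () d 0 (fun m => by
      constructor
      · intro x y; simp only [F]; split_ifs <;> simp
      · intro c x; simp only [F]; split_ifs
        · rw [map_smul, smul_comm]
        · simp) (fun u m => by
      simp only [F, LinearMap.zero_apply]
      rcases lt_or_ge m 0 with hm | hm
      · rw [if_neg (show ¬ 0 ≤ m by omega)]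
        by_cases h1 : m = -1
        · subst h1; simp
        · rw [if_neg (show ¬ 0 ≤ m + 1 by omega)]; simp
      · obtain ⟨k, rfl⟩ := Int.eq_ofNat_of_zero_le hm
        rw [if_pos (by omega), if_pos (by omega)]
        rw [show ((k : ℤ) + 1).toNat = k + 1 by omega, Int.toNat_natCast, pow_succ,
          Module.End.mul_apply, LinearMap.neg_apply, map_neg, smul_neg, smul_neg,
          Nat.factorial_succ, ← Int.cast_smul_eq_zsmul 𝕜, smul_smul]
        push_cast
        rw [mul_inv, ← mul_assoc, mul_inv_cancel₀ (by exact_mod_cast Nat.succ_ne_zero k), one_mul]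
        simp) hw 0 n
  have h1 : shiftComp F () (ezd 𝕜 d w) 0 n = ezd 𝕜 (-d) (ezd 𝕜 d w) n := by
    unfold shiftComp
    rw [ezd]
    apply finsum_congr
    intro i
    simp only [F, zero_add, Ring.choose_natCast, Nat.choose_self, Nat.cast_one, one_smul]
    rw [if_pos (Int.natCast_nonneg i), Int.toNat_natCast]
  rw [← h1, h]
  unfold ezd
  rw [finsum_single]
  · simp [F]
  · intro k hk
    rw [zero_pow hk]; simp

theorem ezd_ezd_neg (d : M →ₗ[𝕜] M) {w : ℤ → M} (hw : Tr w) :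
    ezd 𝕜 d (ezd 𝕜 (-d) w) = w := by
  have := ezd_neg_ezd (-d) hw
  rwa [neg_neg] at this

theorem ezd_derivz (d : M →ₗ[𝕜] M) {w : ℤ → M} (hw : Tr w) :
    derivz (ezd 𝕜 d w) = fun n => ezd 𝕜 d (derivz w) n + ezd 𝕜 d (fun n => d (w n)) n := by
  funext n
  obtain ⟨N, hN⟩ := hw
  let t : ℕ → M := fun k => ((k.factorial : 𝕜)⁻¹) • (d ^ k) (w (n + 1 - (k : ℤ)))
  have ht : ∀ k : ℕ, (n + 1 - N + 1).toNat ≤ k → t k = 0 := ezd_term_zero d hN (n + 1)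
  have h1 : derivz (ezd 𝕜 d w) n = ∑ᶠ k : ℕ, (n + 1) • t k := by
    rw [← smul_finsum' _ (finsupp_of_le _ ht)]; rfl
  have h2 : ezd 𝕜 d (derivz w) n = ∑ᶠ k : ℕ, (n + 1 - (k : ℤ)) • t k := by
    unfold ezd
    apply finsum_congr
    intro k
    simp only [derivz, t]
    rw [map_zsmul, smul_comm, show n - (k : ℤ) + 1 = n + 1 - k by ring]
  have h3 : ezd 𝕜 d (fun n => d (w n)) n = ∑ᶠ k : ℕ, (k : ℤ) • t k := by
    rw [finsum_succ _ (f := fun k : ℕ => (k : ℤ) • t k) (fun k hk => by rw [ht k hk, smul_zero])]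
    simp only [Nat.cast_zero, zero_smul, zero_add]
    unfold ezd
    apply finsum_congr
    intro k
    simp only [t]
    rw [pow_succ, Module.End.mul_apply, ← Int.cast_smul_eq_zsmul 𝕜, smul_smul, Nat.factorial_succ]
    push_cast
    rw [mul_inv, ← mul_assoc, mul_inv_cancel₀ (by exact_mod_cast Nat.succ_ne_zero k), one_mul,
      show n + 1 - ((k : ℤ) + 1) = n - k by ring]
  rw [h1, h2, h3, ← finsum_add_distrib
    (finsupp_of_le _ (fun k hk => by rw [ht k hk, smul_zero]))
    (finsupp_of_le _ (fun k hk => by rw [ht k hk, smul_zero]))]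
  apply finsum_congr
  intro k
  rw [← add_smul, sub_add_cancel]

theorem mulZW_ezd (d : M →ₗ[𝕜] M) (F : ℤ → ℤ → M) (hF : ∀ m, Tr (F m)) (l : ℕ) :
    mulZW l (fun m n => ezd 𝕜 d (F m) n) = fun m n => ezd 𝕜 d (mulZW l F m) n := by
  have key : ∀ l, (∀ m, Tr (mulZW l F m)) ∧
      mulZW l (fun m n => ezd 𝕜 d (F m) n) = fun m n => ezd 𝕜 d (mulZW l F m) n := by
    intro l
    induction l with
    | zero => simp only [mulZW_zero]; exact ⟨hF, trivial⟩
    | succ l ih =>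
      obtain ⟨ih1, ih2⟩ := ih
      have hs : ∀ m, Tr (fun n => mulZW l F m (n - 1)) := fun m => by
        obtain ⟨N, hN⟩ := ih1 m
        exact ⟨N, fun n hn => hN _ (by omega)⟩
      have h1 : ∀ m, mulZW (l + 1) F m = fun n => mulZW l F (m - 1) n + mulZW l F m (n - 1) :=
        fun m => funext fun n => mulZW_succ l F m n
      constructor
      · intro m
        rw [h1]
        obtain ⟨N, hN⟩ := hs m
        obtain ⟨N', hN'⟩ := ih1 (m - 1)
        exact ⟨min N N', fun n hn => by
          have := hN n (by omega)
          simp only at this ⊢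
          rw [this, hN' n (by omega), add_zero]⟩
      · funext m n
        rw [mulZW_succ, ih2, h1, ezd_add d (ih1 _) (hs m)]
        simp only [ezd]
        congr 1
        apply finsum_congr
        intro k
        rw [sub_right_comm]
  exact (key l).2

end Ezd


section Jacobi
variable {M : Type*} [AddCommGroup M]

/-- coefficients of `(x+z)^p C(x,z)`, expanded in nonnegative powers of `x`. -/
noncomputable def TC (C : ℤ → ℤ → M) (p m n : ℤ) : M :=
  ∑ᶠ j : ℕ, Ring.choose p j • C (m - j) (n - p + j)

/-- coefficients of `(x+z)^p A(x+z,z)`. -/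
noncomputable def TA (A : ℤ → ℤ → M) (p m n : ℤ) : M :=
  ∑ᶠ i : ℕ, Ring.choose (m + i) i • A (m - p + i) (n - i)

def Rec (T : ℤ → ℤ → ℤ → M) : Prop :=
  ∀ p m n, T (p + 1) m n = T p (m - 1) n + T p m (n - 1)

theorem TC_rec {C : ℤ → ℤ → M} {K : ℤ} (hC : ∀ m < K, ∀ n, C m n = 0) : Rec (TC C) := by
  intro p m n
  rw [add_comm (TC C p (m - 1) n)]
  unfold TC
  rw [finsum_pascal (fun j => Ring.choose (p + 1) j) (fun j => Ring.choose p j)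
    (fun j => Ring.choose p j) (fun j => C (m - j) (n - (p + 1) + j)) (m - K + 1).toNat
    (fun k hk => hC _ (by omega) _) (by simp)
    (fun j => by rw [Ring.choose_succ_succ, add_comm])]
  congr 1
  · apply finsum_congr; intro j; congr 2; ring
  · apply finsum_congr; intro j; congr 2 <;> (push_cast; ring)

theorem TA_rec {A : ℤ → ℤ → M} {K : ℤ} (hA : ∀ n < K, ∀ m, A m n = 0) : Rec (TA A) := by
  intro p m n
  unfold TA
  rw [finsum_pascal (fun j => Ring.choose (m + j) j) (fun j => Ring.choose (m - 1 + j) j)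
    (fun j => Ring.choose (m + j) j) (fun j => A (m - (p + 1) + j) (n - j)) (n - K + 1).toNat
    (fun k hk => hA _ (by omega) _) (by simp)
    (fun j => by
      push_cast
      rw [← add_assoc, Ring.choose_succ_succ, add_comm, show m - 1 + ((j : ℤ) + 1) = m + j by ring])]
  congr 1
  · apply finsum_congr; intro j; congr 2; ring
  · apply finsum_congr; intro j; congr 2 <;> (push_cast; ring)

theorem TC_van {C : ℤ → ℤ → M} {K : ℤ} (hC : ∀ m < K, ∀ n, C m n = 0) (p m n : ℤ) (hm : m < K) :
    TC C p m n = 0 := by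
  unfold TC
  rw [finsum_eq_range 0 (fun k _ => by rw [hC _ (by omega), smul_zero])]; simp

theorem TA_van {A : ℤ → ℤ → M} {K : ℤ} (hA : ∀ n < K, ∀ m, A m n = 0) (p m n : ℤ) (hn : n < K) :
    TA A p m n = 0 := by
  unfold TA
  rw [finsum_eq_range 0 (fun k _ => by rw [hA _ (by omega), smul_zero])]; simp

theorem TC_zero (C : ℤ → ℤ → M) (m n : ℤ) : TC C 0 m n = C m n := by
  unfold TC
  rw [finsum_single]
  · simp
  · intro k hk
    rw [Ring.choose_zero_pos ℤ (Nat.pos_of_ne_zero hk), zero_smul]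

theorem TA_neg_one (A : ℤ → ℤ → M) (p n : ℤ) : TA A p (-1) n = A (-1 - p) n := by
  unfold TA
  rw [finsum_single]
  · simp
  · intro k hk
    obtain ⟨k, rfl⟩ := Nat.exists_eq_succ_of_ne_zero hk
    rw [show (-1 + ((k.succ : ℕ) : ℤ)) = (k : ℤ) by push_cast; ring, Ring.choose_natCast]
    simp

theorem Rec.up {T : ℤ → ℤ → ℤ → M} (hT : Rec T) {P : ℤ} (h : ∀ m n, T P m n = 0) :
    ∀ p, P ≤ p → ∀ m n, T p m n = 0 := by
  intro p hp
  induction p, hp using Int.leInduction with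
  | base => exact h
  | succ p _ ih => intro m n; rw [hT, ih, ih, add_zero]

theorem Rec.eq_zero_of_step {T : ℤ → ℤ → ℤ → M} (hT : Rec T) {P : ℤ} (h : ∀ m n, T P m n = 0)
    (step : ∀ p, (∀ m n, T p m n = - T p (m + 1) (n - 1)) → ∀ m n, T p m n = 0) :
    ∀ p m n, T p m n = 0 := by
  intro p
  rcases le_total P p with hp | hp
  · exact hT.up h p hp
  · induction p, hp using Int.leInductionDown with
    | base => exact h
    | pred p _ ih =>
      apply step
      intro m n
      have := hT (p - 1) (m + 1) n
      rw [sub_add_cancel, ih, add_sub_cancel_right] at this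
      exact eq_neg_of_add_eq_zero_left this.symm

theorem Rec.zero_n {T : ℤ → ℤ → ℤ → M} (hT : Rec T) {P : ℤ} (h : ∀ m n, T P m n = 0)
    (K : ℤ) (h' : ∀ p m, ∀ n < K, T p m n = 0) : ∀ p m n, T p m n = 0 := by
  apply hT.eq_zero_of_step h
  intro p hp
  have : ∀ t : ℕ, ∀ m, ∀ n < K + t, T p m n = 0 := by
    intro t
    induction t with
    | zero => intro m n hn; exact h' p m n (by simpa using hn)
    | succ t ih => intro m n hn; rw [hp, ih _ _ (by push_cast at hn; omega), neg_zero]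
  intro m n
  exact this (n - K + 1).toNat m n (by omega)

theorem Rec.zero_m {T : ℤ → ℤ → ℤ → M} (hT : Rec T) {P : ℤ} (h : ∀ m n, T P m n = 0)
    (K : ℤ) (h' : ∀ p n, ∀ m < K, T p m n = 0) : ∀ p m n, T p m n = 0 := by
  apply hT.eq_zero_of_step h
  intro p hp
  have : ∀ t : ℕ, ∀ n, ∀ m < K + t, T p m n = 0 := by
    intro t
    induction t with
    | zero => intro n m hm; exact h' p n m (by simpa using hm)
    | succ t ih =>
      intro n m hm
      have := hp (m - 1) (n + 1)
      rw [ih _ _ (by push_cast at hm; omega), sub_add_cancel, add_sub_cancel_right] at this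
      exact neg_eq_zero.mp this.symm
  intro m n
  exact this (m - K + 1).toNat n m (by omega)

theorem Rec.sub {T T' : ℤ → ℤ → ℤ → M} (hT : Rec T) (hT' : Rec T') :
    Rec (fun p m n => T p m n - T' p m n) := by
  intro p m n
  simp only [hT p, hT' p]; abel

theorem Rec.swap {T : ℤ → ℤ → ℤ → M} (hT : Rec T) :
    Rec (fun p m n => eps m • T (-n - 1) m (-p - 1)) := by
  intro p m n
  have := hT (-n - 1) m (-p - 1)
  simp only
  rw [show -(n - 1) - 1 = -n - 1 + 1 by ring, this, show -(p + 1) - 1 = -p - 1 - 1 by ring,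
    eps_sub, eps_one, smul_add]
  simp

theorem Rec.mulZW {T : ℤ → ℤ → ℤ → M} (hT : Rec T) (l : ℕ) : T l = mulZW l (T 0) := by
  have := mulZW_rec (fun l => T l) (fun r m n => by push_cast; exact hT _ _ _) l
  simpa using this

/-- weak commutativity from two associativity relations and skew-symmetry. -/
theorem locality {Aab Aba Cab Cba : ℤ → ℤ → M} {K : ℤ}
    (hAab : ∀ n < K, ∀ m, Aab m n = 0) (hAba : ∀ n < K, ∀ m, Aba m n = 0)
    (hCab : ∀ m < K, ∀ n, Cab m n = 0) (hCba : ∀ m < K, ∀ n, Cba m n = 0)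
    (l : ℕ) (h1 : mulZW l Cab = mulZW l (TA Aab 0)) (h2 : mulZW l Cba = mulZW l (TA Aba 0))
    (skew : ∀ m n, Cab m n = eps m • TC Cba (-n - 1) m (-1)) :
    ∃ k : ℕ, mulZW k (fun m n => eps n • Aab m n) = mulZW k (fun m n => eps n • Aba n m) := by
  have r1 := TC_rec hCab
  have r2 := TC_rec hCba
  have r3 := TA_rec hAab
  have r4 := TA_rec hAba
  have z : ∀ C : ℤ → ℤ → M, TC C 0 = C := fun C => by funext m n; exact TC_zero C m n
  have e1 : ∀ p, (l : ℤ) ≤ p → ∀ m n, TC Cab p m n - TA Aab p m n = 0 := by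
    apply (r1.sub r3).up
    intro m n
    simp only [r1.mulZW l, r3.mulZW l, z, h1, sub_self]
  have e2 : ∀ p, (l : ℤ) ≤ p → ∀ m n, TC Cba p m n - TA Aba p m n = 0 := by
    apply (r2.sub r4).up
    intro m n
    simp only [r2.mulZW l, r4.mulZW l, z, h2, sub_self]
  have sk : ∀ p m n, TC Cab p m n - eps m • TC Cba (-n - 1) m (-p - 1) = 0 := by
    apply (r1.sub r2.swap).zero_m (P := 0) _ K
    · intro p n m hm
      simp only [TC_van hCab p m n hm, TC_van hCba _ m _ hm, smul_zero, sub_self]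
    · intro m n
      simp only [TC_zero, skew, neg_zero, zero_sub, sub_self]
  have J : ∀ p m n, TC Cab p m n - TA Aab p m n - eps m • TA Aba (-n - 1) m (-p - 1) = 0 := by
    apply ((r1.sub r3).sub r4.swap).zero_n (P := max (l : ℤ) (-K)) _ (min K (-(l : ℤ)))
    · intro p m n hn
      have := e2 (-n - 1) (by omega) m (-p - 1)
      rw [TA_van hAab p m n (by omega), sub_zero, ← sub_eq_zero.mp this, sk]
    · intro m n
      rw [e1 _ (by omega), TA_van hAba _ _ _ (by omega), smul_zero, sub_zero]
  refine ⟨(-K).toNat, ?_⟩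
  let RF : ℕ → ℤ → ℤ → M := fun k x y => eps y • TA Aab (-x - 1) (-1 - k) y
  let RG : ℕ → ℤ → ℤ → M := fun k x y => (eps y * - eps (-1 - k)) • TA Aba (-y - 1) (-1 - k) x
  have hRF := mulZW_rec RF (fun k x y => by
    have := r3 (-x - 1) (-1 - k) y
    simp only [RF]
    rw [show -(x - 1) - 1 = -x - 1 + 1 by ring, this, eps_sub, eps_one]
    push_cast
    rw [show -1 - ((k : ℤ) + 1) = -1 - k - 1 by ring]
    simp [smul_add])
  have hRG := mulZW_rec RG (fun k x y => by
    have := r4 (-y - 1) (-1 - k) x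
    simp only [RG]
    rw [show -(y - 1) - 1 = -y - 1 + 1 by ring, this, eps_sub y, eps_one]
    push_cast
    rw [show -1 - ((k : ℤ) + 1) = -1 - k - 1 by ring, eps_sub _ 1, eps_one]
    simp [smul_add])
  have hF0 : RF 0 = fun m n => eps n • Aab m n := by
    funext x y; simp [RF, TA_neg_one, show ∀ x : ℤ, -1 - (-x - 1) = x from fun x => by ring]
  have hG0 : RG 0 = fun m n => eps n • Aba n m := by
    funext x y; simp [RG, TA_neg_one, eps_neg, eps_one, show ∀ x : ℤ, -1 - (-x - 1) = x from fun x => by ring]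
  rw [← hF0, ← hG0, ← hRF, ← hRG]
  funext x y
  simp only [RF, RG]
  have := J (-x - 1) (-1 - (-K).toNat) y
  by_cases hK : -1 - ((-K).toNat : ℤ) < K
  · rw [TC_van hCab _ _ _ hK, zero_sub] at this
    rw [show -(-x - 1) - 1 = x by ring] at this
    rw [mul_smul, neg_smul]
    congr 1
    exact neg_eq_iff_eq_neg.mp (sub_eq_zero.mp this)
  · omega

end Jacobi


section Module
variable {𝕜 : Type*} [Field 𝕜] [CharZero 𝕜]
variable {V W M : Type*} [AddCommGroup V] [Module 𝕜 V] [AddCommGroup W] [Module 𝕜 W]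
  [AddCommGroup M] [Module 𝕜 M]

theorem transl_pow (D : V →ₗ[𝕜] V) (f : V → ℤ → M) (hf : ∀ v, f (D v) = derivz (f v))
    (k : ℕ) (v : V) (n : ℤ) :
    ((k.factorial : 𝕜)⁻¹) • f ((D ^ k) v) n = Ring.choose (n + k) k • f v (n + k) := by
  induction k generalizing v with
  | zero => simp
  | succ k ih =>
    have hk : ((k : 𝕜) + 1) ≠ 0 := by exact_mod_cast Nat.succ_ne_zero k
    rw [pow_succ, Module.End.mul_apply, Nat.factorial_succ]
    push_cast
    rw [mul_inv, mul_smul, ih, hf, inv_smul_eq_iff₀ hk]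
    simp only [derivz]
    rw [smul_smul, mul_comm, ← ring_choose_mul, mul_smul, ← add_assoc]
    rw [← Int.cast_smul_eq_zsmul 𝕜 ((k : ℤ) + 1)]
    push_cast
    rfl

theorem shiftComp_supp {X : Type*} (F : X → W → ℤ → M) (a : X) (h0 : ∀ m, F a 0 m = 0)
    {w : ℤ → W} (hw : Tr w) (m n : ℤ) :
    (Function.support fun i : ℕ =>
      Ring.choose (m + (i : ℤ)) i • F a (w (n - (i : ℤ))) (m + (i : ℤ))).Finite := by
  obtain ⟨N, hN⟩ := hw
  exact finsupp_of_le (n - N + 1).toNat (fun k hk => by rw [hN _ (by omega), h0, smul_zero])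

theorem shiftComp_add {X : Type*} (F : X → W → ℤ → M) (a : X)
    (lin : ∀ m, IsLinearMap 𝕜 (fun u => F a u m))
    {w w' : ℤ → W} (hw : Tr w) (hw' : Tr w') (m n : ℤ) :
    shiftComp F a (fun n => w n + w' n) m n = shiftComp F a w m n + shiftComp F a w' m n := by
  unfold shiftComp
  rw [← finsum_add_distrib (shiftComp_supp F a (fun m => (lin m).map_zero) hw m n)
    (shiftComp_supp F a (fun m => (lin m).map_zero) hw' m n)]
  apply finsum_congr
  intro i
  rw [(lin _).map_add, smul_add]

theorem shiftComp_van {X : Type*} (F : X → W → ℤ → M) (a : X) (h0 : ∀ m, F a 0 m = 0)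
    {w : ℤ → W} (hw : Tr w) (m : ℤ) : Tr (shiftComp F a w m) := by
  obtain ⟨N, hN⟩ := hw
  refine ⟨N, fun n hn => ?_⟩
  unfold shiftComp
  rw [finsum_eq_range 0 (fun k _ => by rw [hN _ (by omega), h0, smul_zero])]; simp

theorem Tr.add {w w' : ℤ → M} (hw : Tr w) (hw' : Tr w') : Tr (fun n => w n + w' n) := by
  obtain ⟨N, hN⟩ := hw
  obtain ⟨N', hN'⟩ := hw'
  exact ⟨min N N', fun n hn => by
    show w n + w' n = 0
    rw [hN n (by omega), hN' n (by omega), add_zero]⟩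

variable {Y : V → V → ℤ → V} {one : V} {D : V →ₗ[𝕜] V} {YM : V → M → ℤ → M} {d : M →ₗ[𝕜] M}

theorem rAct_Tr (hM : IsVModule 𝕜 Y one D YM d) (u : M) (a : V) : Tr (rAct 𝕜 YM d u a) :=
  ezd_Tr d (negz_Tr (hM.trunc a u))

theorem rAct_lin_left (hM : IsVModule 𝕜 Y one D YM d) (a : V) (n : ℤ) :
    IsLinearMap 𝕜 (fun u => rAct 𝕜 YM d u a n) := by
  constructor
  · intro u v
    have := congrFun (ezd_add d (negz_Tr (hM.trunc a u)) (negz_Tr (hM.trunc a v))) n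
    unfold rAct
    rw [← this]
    congr 1; funext k
    simp only [negz_apply, (hM.linear_right a k).map_add, smul_add]
  · intro c u
    have := congrFun (ezd_smul d c (negz_Tr (hM.trunc a u))) n
    unfold rAct
    rw [← this]
    congr 1; funext k
    simp only [negz_apply, (hM.linear_right a k).map_smul, smul_comm c]

theorem rAct_lin_right (hM : IsVModule 𝕜 Y one D YM d) (u : M) (n : ℤ) :
    IsLinearMap 𝕜 (fun a => rAct 𝕜 YM d u a n) := by
  constructor
  · intro a b
    have := congrFun (ezd_add d (negz_Tr (hM.trunc a u)) (negz_Tr (hM.trunc b u))) n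
    unfold rAct
    rw [← this]
    congr 1; funext k
    simp only [negz_apply, (hM.linear_left u k).map_add, smul_add]
  · intro c a
    have := congrFun (ezd_smul d c (negz_Tr (hM.trunc a u))) n
    unfold rAct
    rw [← this]
    congr 1; funext k
    simp only [negz_apply, (hM.linear_left u k).map_smul, smul_comm c]

theorem rAct_deriv (hM : IsVModule 𝕜 Y one D YM d) (u : M) (a : V) (n : ℤ) :
    d (rAct 𝕜 YM d u a n) = rAct 𝕜 YM d (d u) a n + rAct 𝕜 YM d u (D a) n := by
  have h1 := congrFun (ezd_lin d d (fun _ => rfl) (negz_Tr (hM.trunc a u))) n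
  have h2 := congrFun (ezd_add d (negz_Tr (hM.trunc a (d u))) (negz_Tr (hM.trunc (D a) u))) n
  unfold rAct
  rw [← h1, ← h2]
  congr 1; funext k
  simp only [negz_apply, map_zsmul, hM.derivation, smul_add, add_comm]

theorem rAct_transl (hM : IsVModule 𝕜 Y one D YM d) (u : M) (a : V) :
    rAct 𝕜 YM d (d u) a = derivz (rAct 𝕜 YM d u a) := by
  have hT := negz_Tr (hM.trunc a u)
  have hT' : Tr (derivz (negz (YM a u))) := by
    obtain ⟨N, hN⟩ := hT
    exact ⟨N - 1, fun n hn => by rw [derivz, hN _ (by omega), smul_zero]⟩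
  have hT'' : Tr (fun n => d (negz (YM a u) n)) := by
    obtain ⟨N, hN⟩ := hT
    exact ⟨N, fun n hn => by simp only [hN n hn, map_zero]⟩
  unfold rAct
  rw [ezd_derivz d hT, ← ezd_add d hT' hT'']
  congr 1; funext k
  simp only [derivz, negz_apply, map_zsmul, hM.derivation, hM.transl, eps_add, eps_one, smul_add]
  rw [smul_comm (k + 1)]
  simp

theorem rAct_invol (hM : IsVModule 𝕜 Y one D YM d) (u : M) (a : V) :
    ezd 𝕜 d (negz (rAct 𝕜 YM d u a)) = YM a u := by
  unfold rAct
  rw [negz_ezd d (hM.trunc a u), ezd_ezd_neg d (hM.trunc a u)]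

theorem module_skew (hV : IsVertexAlg 𝕜 Y one D) (hM : IsVModule 𝕜 Y one D YM d)
    (a b : V) (u : M) (m n : ℤ) :
    YM (Y a b m) u n = eps m • TC (fun m n => YM (Y b a m) u n) (-n - 1) m (-1) := by
  have hT := negz_Tr (hV.trunc b a)
  conv_lhs => rw [hV.comm a b]
  have := (hM.linear_left u n).mk'.toAddMonoidHom.map_finsum (ezd_supp D hT m)
  refine Eq.trans this ?_
  unfold TC
  rw [smul_finsum']
  · apply finsum_congr
    intro k
    change YM _ u n = _
    rw [(hM.linear_left u n).map_smul,
      transl_pow D (fun v => YM v u) (fun v => hM.transl v u), ring_choose_neg, negz_apply,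
      show -1 - (-n - 1) + (k : ℤ) = n + k by ring]
    have := (hM.linear_left u (n + k)).mk'.map_smul_of_tower (eps (m - k)) (Y b a (m - k))
    simp only [IsLinearMap.mk'_apply] at this
    rw [this, eps_sub, smul_smul, smul_smul]
    congr 1; ring
  · obtain ⟨N, hN⟩ := hV.trunc b a
    exact finsupp_of_le (m - N + 1).toNat (fun k hk => by
      simp only
      rw [hN _ (by omega), (hM.linear_left u _).map_zero, smul_zero])

theorem module_locality (hV : IsVertexAlg 𝕜 Y one D) (hM : IsVModule 𝕜 Y one D YM d)
    (a b : V) (u : M) : ∃ k : ℕ,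
    mulZW k (fun m n => eps n • YM a (YM b u n) m) =
      mulZW k (fun m n => eps n • YM b (YM a u m) n) := by
  obtain ⟨l1, h1⟩ := hM.assoc a b u
  obtain ⟨l2, h2⟩ := hM.assoc b a u
  obtain ⟨K1, hK1⟩ := hM.trunc a u
  obtain ⟨K2, hK2⟩ := hM.trunc b u
  obtain ⟨K3, hK3⟩ := hV.trunc a b
  obtain ⟨K4, hK4⟩ := hV.trunc b a
  have e : ∀ a b : V, shiftComp YM a (YM b u) = TA (fun m n => YM a (YM b u n) m) 0 := by
    intro a b; funext m n; simp [shiftComp, TA]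
  exact locality (Aab := fun m n => YM a (YM b u n) m) (Aba := fun m n => YM b (YM a u n) m)
    (Cab := fun m n => YM (Y a b m) u n) (Cba := fun m n => YM (Y b a m) u n)
    (K := min (min K1 K2) (min K3 K4))
    (fun n hn m => by simp only [hK2 n (by omega), (hM.linear_right a m).map_zero])
    (fun n hn m => by simp only [hK1 n (by omega), (hM.linear_right b m).map_zero])
    (fun m hm n => by simp only [hK3 m (by omega), (hM.linear_left u n).map_zero])
    (fun m hm n => by simp only [hK4 m (by omega), (hM.linear_left u n).map_zero])
    (l1 + l2)
    (by rw [← e]; exact mulZW_mono (by omega) h1)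
    (by rw [← e]; exact mulZW_mono (by omega) h2)
    (module_skew hV hM a b u)

/-- associativity for `(a, v, c)` with `v ∈ M`. -/
theorem assoc_mid (hV : IsVertexAlg 𝕜 Y one D) (hM : IsVModule 𝕜 Y one D YM d)
    (a c : V) (v : M) : ∃ l : ℕ,
    mulZW l (fun m n => rAct 𝕜 YM d (YM a v m) c n) =
      mulZW l (shiftComp YM a (rAct 𝕜 YM d v c)) := by
  obtain ⟨k, hk⟩ := module_locality hV hM a c v
  refine ⟨k, ?_⟩
  have h1 : shiftComp YM a (rAct 𝕜 YM d v c)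
      = fun m n => ezd 𝕜 d (fun n => eps n • YM a (YM c v n) m) n := by
    funext m n
    unfold rAct
    rw [shiftComp_ezd YM a d d (hM.linear_right a)
      (fun u m => by rw [hM.derivation, hM.transl]; rfl) (negz_Tr (hM.trunc c v))]
    congr 1; funext n'
    rw [negz_apply]
    exact (hM.linear_right a m).mk'.map_smul_of_tower (eps n') _
  rw [h1, mulZW_ezd d (fun m n => eps n • YM a (YM c v n) m), hk]
  · rw [← mulZW_ezd d (fun m n => eps n • YM c (YM a v m) n)]
    · rfl
    · intro m; exact negz_Tr (hM.trunc c (YM a v m))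
  · intro m
    obtain ⟨N, hN⟩ := hM.trunc c v
    exact ⟨N, fun n hn => by simp only [hN n hn, (hM.linear_right a m).map_zero, smul_zero]⟩

/-- associativity for `(u, b, c)` with `u ∈ M`. -/
theorem assoc_left (hV : IsVertexAlg 𝕜 Y one D) (hM : IsVModule 𝕜 Y one D YM d)
    (b c : V) (u : M) : ∃ l : ℕ,
    mulZW l (fun m n => rAct 𝕜 YM d (rAct 𝕜 YM d u b m) c n) =
      mulZW l (shiftComp (rAct 𝕜 YM d) u (Y b c)) := by
  obtain ⟨l, hl⟩ := hM.assoc c b u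
  refine ⟨l, ?_⟩
  -- right-hand side
  have hR : shiftComp (rAct 𝕜 YM d) u (Y b c) = fun m n => ezd 𝕜 d (fun n' =>
      ezd 𝕜 d (fun m' => eps (n' + m') • YM (Y c b n') u m') m) n := by
    funext m n
    rw [hV.comm b c, shiftComp_ezd (rAct 𝕜 YM d) u D d (rAct_lin_right hM u)
      (fun a m => by rw [rAct_deriv hM, rAct_transl hM]; rfl) (negz_Tr (hV.trunc c b))]
    congr 1; funext n'
    rw [negz_apply]
    have := (rAct_lin_right hM u m).mk'.map_smul_of_tower (eps n') (Y c b n')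
    simp only [IsLinearMap.mk'_apply] at this
    rw [this]
    unfold rAct
    rw [← congrFun (ezd_zsmul d (eps n') (negz_Tr (hM.trunc _ u))) m]
    congr 1; funext m'
    rw [negz_apply, smul_smul, eps_add]
  have hL0 : ∀ m n', ezd 𝕜 d (fun m' => eps (n' + m') • shiftComp YM c (YM b u) n' m') m
      = negz (YM c (rAct 𝕜 YM d u b m)) n' := by
    intro m n'
    let F : V → M → ℤ → M := fun c u n => eps n • YM c u n
    have linF : ∀ m, IsLinearMap 𝕜 (fun u => F c u m) := fun m =>
      (eps m • (hM.linear_right c m).mk').isLinear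
    have hw := negz_Tr (hM.trunc b u)
    have h1 : ∀ m, shiftComp F c (negz (YM b u)) n' m
        = ezd 𝕜 (-d) (fun m' => F c (rAct 𝕜 YM d u b m') n') m := by
      intro m
      rw [← shiftComp_ezd F c (-d) (-d) linF _ (rAct_Tr hM u b)]
      · unfold rAct
        rw [ezd_neg_ezd d hw]
      · intro v k
        have h2 : F c ((-d) v) k = - F c (d v) k := by
          rw [LinearMap.neg_apply]; exact (linF k).map_neg _
        rw [h2]
        simp only [F, LinearMap.neg_apply, map_zsmul, hM.derivation, hM.transl, derivz, eps_add,
          eps_one, smul_add]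
        rw [smul_comm (k + 1)]
        simp [add_comm]
    have h3 : (fun m' => eps (n' + m') • shiftComp YM c (YM b u) n' m')
        = ezd 𝕜 (-d) (fun m' => F c (rAct 𝕜 YM d u b m') n') := by
      funext m'
      rw [← h1]
      unfold shiftComp
      rw [smul_finsum' _ (shiftComp_supp YM c (fun m => (hM.linear_right c m).map_zero)
        (hM.trunc b u) n' m')]
      apply finsum_congr
      intro i
      simp only [F, negz_apply]
      have := (hM.linear_right c (n' + i)).mk'.map_smul_of_tower (eps (m' - i)) (YM b u (m' - i))
      simp only [IsLinearMap.mk'_apply] at this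
      rw [this, smul_smul, smul_smul, smul_smul]
      congr 1
      rw [eps_add, eps_add, eps_sub]
      linear_combination (-(Ring.choose (n' + (i : ℤ)) i * eps n' * eps m')) * eps_mul_self i
    rw [h3, ezd_ezd_neg d]
    · rfl
    · obtain ⟨N, hN⟩ := rAct_Tr hM u b
      exact ⟨N, fun n hn => by simp only [hN n hn, (linF _).map_zero]⟩
  have hL : (fun m n => rAct 𝕜 YM d (rAct 𝕜 YM d u b m) c n) = fun m n => ezd 𝕜 d (fun n' =>
      ezd 𝕜 d (fun m' => eps (n' + m') • shiftComp YM c (YM b u) n' m') m) n := by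
    simp only [hL0]
    rfl
  -- both sides as iterated exponentials
  have key : ∀ H : ℤ → ℤ → M, (∀ n, Tr (H n)) →
      (∀ m, Tr (fun n' => ezd 𝕜 d (fun m' => eps (n' + m') • H n' m') m)) →
      mulZW l (fun m n => ezd 𝕜 d (fun n' => ezd 𝕜 d (fun m' => eps (n' + m') • H n' m') m) n)
      = fun m n => ezd 𝕜 d (fun n' => ezd 𝕜 d (fun m' =>
          (eps l * eps (n' + m')) • mulZW l H n' m') m) n := by
    intro H h1 h2
    have h1' : ∀ n', Tr (fun m' => eps (n' + m') • H n' m') := by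
      intro n'
      obtain ⟨N, hN⟩ := h1 n'
      exact ⟨N, fun n hn => by simp only [hN n hn, smul_zero]⟩
    rw [mulZW_ezd d (fun m n' => ezd 𝕜 d (fun m' => eps (n' + m') • H n' m') m) h2]
    rw [mulZW_swap l (fun n' m => ezd 𝕜 d (fun m' => eps (n' + m') • H n' m') m)]
    rw [mulZW_ezd d (fun n' m' => eps (n' + m') • H n' m') h1']
    rw [mulZW_eps]
  rw [hL, hR, key _ _ _, key (fun n m => YM (Y c b n) u m) _ _, hl]
  · intro n; exact hM.trunc _ u
  · intro m
    obtain ⟨N, hN⟩ := hV.trunc c b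
    refine ⟨N, fun n hn => ?_⟩
    simp only [hN n hn, (hM.linear_left u _).map_zero, smul_zero, ezd_zero]
  · intro n
    exact shiftComp_van YM c (fun m => (hM.linear_right c m).map_zero) (hM.trunc b u) n
  · intro m
    simp only [hL0]
    exact negz_Tr (hM.trunc c _)

end Module


section Ext
variable {𝕜 : Type*} [Field 𝕜] [CharZero 𝕜]
variable {V M : Type*} [AddCommGroup V] [Module 𝕜 V] [AddCommGroup M] [Module 𝕜 M]

theorem ezd_prod (D : V →ₗ[𝕜] V) (d : M →ₗ[𝕜] M) {w : ℤ → V × M} (hw : Tr w) (n : ℤ) :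
    ezd 𝕜 (D.prodMap d) w n
      = (ezd 𝕜 D (fun n => (w n).1) n, ezd 𝕜 d (fun n => (w n).2) n) := by
  have hp : ∀ (k : ℕ) (x : V × M), ((D.prodMap d) ^ k) x = ((D ^ k) x.1, (d ^ k) x.2) := by
    intro k
    induction k with
    | zero => intro x; simp
    | succ k ih => intro x; simp [pow_succ, ih]
  have h := ezd_supp (D.prodMap d) hw n
  apply Prod.ext
  · refine ((AddMonoidHom.fst V M).map_finsum h).trans ?_
    apply finsum_congr
    intro k
    simp [hp]
  · refine ((AddMonoidHom.snd V M).map_finsum h).trans ?_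
    apply finsum_congr
    intro k
    simp [hp]

theorem mulZW_prod (l : ℕ) (F : ℤ → ℤ → V × M) (m n : ℤ) :
    mulZW l F m n = (mulZW l (fun m n => (F m n).1) m n, mulZW l (fun m n => (F m n).2) m n) := by
  apply Prod.ext <;> simp [mulZW, Prod.fst_sum, Prod.snd_sum]

variable {Y : V → V → ℤ → V} {one : V} {D : V →ₗ[𝕜] V} {YM : V → M → ℤ → M} {d : M →ₗ[𝕜] M}
  {ψ : V → V → ℤ → M}

theorem extY_linear_left (hV : IsVertexAlg 𝕜 Y one D) (hM : IsVModule 𝕜 Y one D YM d)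
    (hψ : IsC2 𝕜 one D d ψ) (q : V × M) (n : ℤ) :
    IsLinearMap 𝕜 (fun p => extY 𝕜 Y YM d ψ p q n) := by
  constructor
  · intro x y
    simp only [extY, Prod.fst_add, Prod.snd_add, (hV.linear_left _ _).map_add,
      (hM.linear_left _ _).map_add, (rAct_lin_left hM _ _).map_add, (hψ.linear_left _ _).map_add,
      Prod.mk_add_mk]
    congr 1; abel
  · intro c x
    simp only [extY, Prod.smul_fst, Prod.smul_snd, (hV.linear_left _ _).map_smul,
      (hM.linear_left _ _).map_smul, (rAct_lin_left hM _ _).map_smul,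
      (hψ.linear_left _ _).map_smul, Prod.smul_mk, smul_add]

theorem extY_linear_right (hV : IsVertexAlg 𝕜 Y one D) (hM : IsVModule 𝕜 Y one D YM d)
    (hψ : IsC2 𝕜 one D d ψ) (p : V × M) (n : ℤ) :
    IsLinearMap 𝕜 (fun q => extY 𝕜 Y YM d ψ p q n) := by
  constructor
  · intro x y
    simp only [extY, Prod.fst_add, Prod.snd_add, (hV.linear_right _ _).map_add,
      (hM.linear_right _ _).map_add, (rAct_lin_right hM _ _).map_add,
      (hψ.linear_right _ _).map_add, Prod.mk_add_mk]
    congr 1; abel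
  · intro c x
    simp only [extY, Prod.smul_fst, Prod.smul_snd, (hV.linear_right _ _).map_smul,
      (hM.linear_right _ _).map_smul, (rAct_lin_right hM _ _).map_smul,
      (hψ.linear_right _ _).map_smul, Prod.smul_mk, smul_add]

theorem extY_Tr (hV : IsVertexAlg 𝕜 Y one D) (hM : IsVModule 𝕜 Y one D YM d)
    (hψ : IsC2 𝕜 one D d ψ) (p q : V × M) : Tr (extY 𝕜 Y YM d ψ p q) := by
  obtain ⟨N1, h1⟩ := hV.trunc p.1 q.1
  obtain ⟨N2, h2⟩ := ((Tr.add (hM.trunc p.1 q.2) (rAct_Tr hM p.2 q.1)).add (hψ.trunc p.1 q.1))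
  exact ⟨min N1 N2, fun n hn => Prod.ext (h1 n (by omega)) (h2 n (by omega))⟩

theorem shiftComp_ext (hV : IsVertexAlg 𝕜 Y one D) (hM : IsVModule 𝕜 Y one D YM d)
    (hψ : IsC2 𝕜 one D d ψ) (p : V × M) {s : ℤ → V × M} (hs : Tr s) (m n : ℤ) :
    shiftComp (extY 𝕜 Y YM d ψ) p s m n =
      (shiftComp Y p.1 (fun n => (s n).1) m n,
        shiftComp YM p.1 (fun n => (s n).2) m n
          + shiftComp (rAct 𝕜 YM d) p.2 (fun n => (s n).1) m n
          + shiftComp ψ p.1 (fun n => (s n).1) m n) := by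
  have hs1 : Tr (fun n => (s n).1) := by
    obtain ⟨N, hN⟩ := hs
    exact ⟨N, fun n hn => by simp [hN n hn]⟩
  have hs2 : Tr (fun n => (s n).2) := by
    obtain ⟨N, hN⟩ := hs
    exact ⟨N, fun n hn => by simp [hN n hn]⟩
  have h := shiftComp_supp (extY 𝕜 Y YM d ψ) p
    (fun m => (extY_linear_right hV hM hψ p m).map_zero) hs m n
  have f1 := shiftComp_supp YM p.1 (fun m => (hM.linear_right p.1 m).map_zero) hs2 m n
  have f2 := shiftComp_supp (rAct 𝕜 YM d) p.2
    (fun m => (rAct_lin_right hM p.2 m).map_zero) hs1 m n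
  have f3 := shiftComp_supp ψ p.1 (fun m => (hψ.linear_right p.1 m).map_zero) hs1 m n
  apply Prod.ext
  · refine ((AddMonoidHom.fst V M).map_finsum h).trans ?_
    apply finsum_congr
    intro k
    simp [extY]
  · refine ((AddMonoidHom.snd V M).map_finsum h).trans ?_
    unfold shiftComp
    rw [← finsum_add_distrib f1 f2, ← finsum_add_distrib _ f3]
    · apply finsum_congr
      intro k
      simp [extY]
    · exact (f1.union f2).subset (Function.support_add _ _)

/-- second component of the left side of associativity -/
theorem ext_assoc_iff (hV : IsVertexAlg 𝕜 Y one D) (hM : IsVModule 𝕜 Y one D YM d)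
    (hψ : IsC2 𝕜 one D d ψ) (p q r : V × M) (l : ℕ) :
    mulZW l (fun m n => extY 𝕜 Y YM d ψ (extY 𝕜 Y YM d ψ p q m) r n)
        = mulZW l (shiftComp (extY 𝕜 Y YM d ψ) p (extY 𝕜 Y YM d ψ q r)) ↔
    mulZW l (fun m n => Y (Y p.1 q.1 m) r.1 n) = mulZW l (shiftComp Y p.1 (Y q.1 r.1)) ∧
    (∀ m n, mulZW l (fun m n => YM (Y p.1 q.1 m) r.2 n) m n
      + mulZW l (fun m n => rAct 𝕜 YM d (YM p.1 q.2 m) r.1 n) m n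
      + mulZW l (fun m n => rAct 𝕜 YM d (rAct 𝕜 YM d p.2 q.1 m) r.1 n) m n
      + mulZW l (fun m n => ψ (Y p.1 q.1 m) r.1 n + rAct 𝕜 YM d (ψ p.1 q.1 m) r.1 n) m n
      = mulZW l (shiftComp YM p.1 (YM q.1 r.2)) m n
      + mulZW l (shiftComp YM p.1 (rAct 𝕜 YM d q.2 r.1)) m n
      + mulZW l (shiftComp (rAct 𝕜 YM d) p.2 (Y q.1 r.1)) m n
      + mulZW l (fun m n => shiftComp YM p.1 (ψ q.1 r.1) m n
          + shiftComp ψ p.1 (Y q.1 r.1) m n) m n) := by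
  have hL2 : (fun m n => (extY 𝕜 Y YM d ψ (extY 𝕜 Y YM d ψ p q m) r n).2)
      = fun m n => YM (Y p.1 q.1 m) r.2 n + rAct 𝕜 YM d (YM p.1 q.2 m) r.1 n
        + rAct 𝕜 YM d (rAct 𝕜 YM d p.2 q.1 m) r.1 n
        + (ψ (Y p.1 q.1 m) r.1 n + rAct 𝕜 YM d (ψ p.1 q.1 m) r.1 n) := by
    funext m n
    simp only [extY, (rAct_lin_left hM _ _).map_add]
    abel
  have hR := fun m n => shiftComp_ext hV hM hψ p (extY_Tr hV hM hψ q r) m n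
  have hR1 : (fun m n => (shiftComp (extY 𝕜 Y YM d ψ) p (extY 𝕜 Y YM d ψ q r) m n).1)
      = shiftComp Y p.1 (Y q.1 r.1) := by
    funext m n; rw [hR]; rfl
  have hR2 : (fun m n => (shiftComp (extY 𝕜 Y YM d ψ) p (extY 𝕜 Y YM d ψ q r) m n).2)
      = fun m n => shiftComp YM p.1 (YM q.1 r.2) m n
        + shiftComp YM p.1 (rAct 𝕜 YM d q.2 r.1) m n
        + shiftComp (rAct 𝕜 YM d) p.2 (Y q.1 r.1) m n
        + (shiftComp YM p.1 (ψ q.1 r.1) m n + shiftComp ψ p.1 (Y q.1 r.1) m n) := by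
    funext m n
    rw [hR]
    simp only [extY]
    rw [shiftComp_add YM p.1 (hM.linear_right p.1)
      ((Tr.add (hM.trunc q.1 r.2) (rAct_Tr hM q.2 r.1))) (hψ.trunc q.1 r.1),
      shiftComp_add YM p.1 (hM.linear_right p.1) (hM.trunc q.1 r.2) (rAct_Tr hM q.2 r.1)]
    change _ + shiftComp (rAct 𝕜 YM d) p.2 (Y q.1 r.1) m n + shiftComp ψ p.1 (Y q.1 r.1) m n = _
    abel
  have hL3 := congrArg (mulZW l) hL2
  have hR3 := congrArg (mulZW l) hR2
  rw [mulZW_add, mulZW_add, mulZW_add] at hL3 hR3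
  constructor
  · intro h
    constructor
    · funext m n
      have := congrArg Prod.fst (congrFun (congrFun h m) n)
      rw [mulZW_prod, mulZW_prod, hR1] at this
      exact this
    · intro m n
      have := congrArg Prod.snd (congrFun (congrFun h m) n)
      rw [mulZW_prod, mulZW_prod] at this
      simp only at this
      rw [hL3, hR3] at this
      exact this
  · rintro ⟨h1, h2⟩
    funext m n
    rw [mulZW_prod, mulZW_prod]
    apply Prod.ext
    · simp only
      rw [hR1]
      exact congrFun (congrFun h1 m) n
    · simp only
      rw [hL3, hR3]
      exact h2 m n

end Ext
end Helpers


variable (𝕜 : Type*) [Field 𝕜] [CharZero 𝕜]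
  {V M : Type*} [AddCommGroup V] [Module 𝕜 V] [AddCommGroup M] [Module 𝕜 M]
  (Y : V → V → ℤ → V) (one : V) (D : V →ₗ[𝕜] V)
  (YM : V → M → ℤ → M) (d : M →ₗ[𝕜] M)

/-- for `ψ ∈ C²(V,M)`, `(V ⊕ M, extY, (𝟙,0), D ⊕ d)` is a vertex
algebra iff `ψ ∈ Z²(V,M)`, i.e. iff `ψ` satisfies the 2-cocycle condition. -/
theorem extension_isVertexAlg_iff_cocycle
    (hV : IsVertexAlg 𝕜 Y one D) (hM : IsVModule 𝕜 Y one D YM d)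
    (ψ : V → V → ℤ → M) (hψ : IsC2 𝕜 one D d ψ) :
    IsVertexAlg 𝕜 (extY 𝕜 Y YM d ψ) ((one, 0) : V × M) (D.prodMap d)
      ↔ Cocycle 𝕜 Y YM d ψ := by
  constructor
  · intro h a b c
    obtain ⟨l, hl⟩ := h.assoc (a, 0) (b, 0) (c, 0)
    refine ⟨l, ?_⟩
    have := ((ext_assoc_iff hV hM hψ _ _ _ l).mp hl).2
    have z1 : ∀ x : V, YM x 0 = fun _ => 0 := fun x =>
      funext fun n => (hM.linear_right x n).map_zero
    have z2 : ∀ x : V, rAct 𝕜 YM d 0 x = fun _ => 0 := fun x =>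
      funext fun n => (rAct_lin_left hM x n).map_zero
    have z3 : ∀ x : V, shiftComp YM x (fun _ => 0) = fun _ _ => 0 := fun x => by
      funext m n; simp [shiftComp, z1]
    have z4 : shiftComp (rAct 𝕜 YM d) 0 (Y b c) = fun _ _ => 0 := by
      funext m n; simp [shiftComp, z2]
    have z5 : ∀ m n, mulZW l (fun _ _ => (0 : M)) m n = 0 := fun m n => by simp [mulZW]
    simp only [z1, z2, z3, z4, z5, zero_add] at this
    funext m n
    exact this m n
  · intro h
    refine ⟨extY_linear_left hV hM hψ, extY_linear_right hV hM hψ, extY_Tr hV hM hψ,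
      ?_, ?_, ?_, ?_, ?_, ?_⟩
    · rintro ⟨a, u⟩
      funext n
      have := (rAct_lin_left hM a n).map_zero
      simp only [extY, hV.unit_left, hM.unit, hψ.unit_left, this]
      simp only [unitSeries, Pi.zero_apply]
      split_ifs <;> simp
    · rintro ⟨a, u⟩
      funext n
      rw [ezd_prod D d ⟨0, fun n hn => by simp [unitSeries, hn.ne]⟩]
      have h1 : (fun n => (unitSeries (a, u) n).1) = unitSeries a := by
        funext n; simp only [unitSeries]; split_ifs <;> rfl
      have h2 : (fun n => (unitSeries (a, u) n).2) = unitSeries u := by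
        funext n; simp only [unitSeries]; split_ifs <;> rfl
      have h3 : negz (unitSeries u) = unitSeries u := by
        funext n; rw [negz_apply]; simp only [unitSeries]; split_ifs with hn
        · rw [hn, eps_zero, one_smul]
        · rw [smul_zero]
      rw [h1, h2]
      simp only [extY, hV.unit_right, hψ.unit_right, (hM.linear_right a n).map_zero, rAct, hM.unit,
        h3, zero_add, Pi.zero_apply, add_zero]
    · rintro ⟨a, u⟩ ⟨b, v⟩
      funext n
      simp only [extY, LinearMap.prodMap_apply, hV.transl, hM.transl, rAct_transl hM, ← hψ.transl,
        derivz, Prod.smul_mk, smul_add]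
    · rintro ⟨a, u⟩ ⟨b, v⟩ n
      simp only [extY, LinearMap.prodMap_apply, map_add, hV.derivation, hM.derivation,
        rAct_deriv hM, hψ.derivation, Prod.mk_add_mk]
      congr 1; abel
    · rintro ⟨a, u⟩ ⟨b, v⟩
      funext n
      rw [ezd_prod D d (negz_Tr (extY_Tr hV hM hψ _ _))]
      have h2 : (fun n => (negz (extY 𝕜 Y YM d ψ (b, v) (a, u)) n).2)
          = fun n => negz (YM b u) n + negz (rAct 𝕜 YM d v a) n + negz (ψ b a) n := by
        funext n
        simp only [negz_apply, extY, Prod.smul_snd, smul_add]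
      rw [h2, ezd_add d (Tr.add (negz_Tr (hM.trunc b u)) (negz_Tr (rAct_Tr hM v a)))
        (negz_Tr (hψ.trunc b a)), ezd_add d (negz_Tr (hM.trunc b u)) (negz_Tr (rAct_Tr hM v a)),
        rAct_invol hM, ← hψ.symm a b]
      simp only [extY]
      apply Prod.ext
      · simp only
        rw [hV.comm a b]
        rfl
      · simp only [rAct]
        abel
    · intro p q r
      obtain ⟨l0, h0⟩ := hV.assoc p.1 q.1 r.1
      obtain ⟨l1, h1⟩ := hM.assoc p.1 q.1 r.2
      obtain ⟨l2, h2⟩ := assoc_mid hV hM p.1 r.1 q.2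
      obtain ⟨l3, h3⟩ := assoc_left hV hM q.1 r.1 p.2
      obtain ⟨l4, h4⟩ := h p.1 q.1 r.1
      refine ⟨l0 + l1 + l2 + l3 + l4, ?_⟩
      rw [ext_assoc_iff hV hM hψ]
      refine ⟨mulZW_mono (by omega) h0, fun m n => ?_⟩
      rw [mulZW_mono (l' := l0 + l1 + l2 + l3 + l4) (by omega) h1,
        mulZW_mono (l' := l0 + l1 + l2 + l3 + l4) (by omega) h2,
        mulZW_mono (l' := l0 + l1 + l2 + l3 + l4) (by omega) h3,
        mulZW_mono (l' := l0 + l1 + l2 + l3 + l4) (by omega) h4]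

end VertexCohomology
end
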